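/- For any k-bounded partitions λ and μ: 𝒦^{(k)}_{λλ} = 1; 𝒦^{(k)}_{λμ} = 0 whenever |μ| = |λ| and λ does not dominate μ; and 𝒦^{(k)}_{λμ} = 0 whenever |μ| < |λ|. -/

import Mathlib

open scoped Classical

namespace AffineKTheory

noncomputable instance : Nonempty YoungDiagram := ⟨⊥⟩

noncomputable instance : Nonempty YoungDiagram := ⟨⊥⟩

/-! ## Cells, hooks, cores, residues -/

/-- Hook length of the cell `(r, c)` in the diagram `γ`. -/
def hookLen (γ : YoungDiagram) (r c : ℕ) : ℕ :=
  (γ.rowLen r - c) + (γ.colLen c - r) - 1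

/-- A `p`-core: a diagram none of whose cells has hook length `p`. -/
def IsCore (p : ℕ) (γ : YoungDiagram) : Prop :=
  ∀ c : ℕ × ℕ, c ∈ γ → hookLen γ c.1 c.2 ≠ p

/-- The `(k+1)`-residue of a cell.  (Rows of the Ferrers shape are indexed so that the cell
directly above `(r, c)` -- in the Ferrers sense of the next, shorter, row -- is `(r+1, c)`.) -/
def residue (k : ℕ) (c : ℕ × ℕ) : ZMod (k + 1) :=
  (c.2 : ZMod (k + 1)) - (c.1 : ZMod (k + 1))

/-- A removable corner of `γ`: a cell of `γ` with no cell above it nor to its right. -/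
def Removable (γ : YoungDiagram) (c : ℕ × ℕ) : Prop :=
  c ∈ γ ∧ (c.1 + 1, c.2) ∉ γ ∧ (c.1, c.2 + 1) ∉ γ

/-- An addable corner of `γ`: a cell outside `γ` whose addition again yields a partition shape. -/
def Addable (γ : YoungDiagram) (c : ℕ × ℕ) : Prop :=
  c ∉ γ ∧ ∀ d : ℕ × ℕ, d ≤ c → d ≠ c → d ∈ γ

/-- A cell is `γ`-blocked if it lies below a cell of `γ`. -/
def Blocked (γ : YoungDiagram) (c : ℕ × ℕ) : Prop :=
  (c.1 + 1, c.2) ∈ γ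

/-- The number of cells of `γ` in row `i` whose hook length is at most `k`:
the `i`-th part of `𝔭(γ)`. -/
noncomputable def pRow (k : ℕ) (γ : YoungDiagram) (i : ℕ) : ℕ :=
  (γ.cells.filter (fun c => c.1 = i ∧ hookLen γ c.1 c.2 ≤ k)).card

/-- The number of cells of `γ` with `k`-bounded hook length, i.e. `|𝔭(γ)|`. -/
noncomputable def pSize (k : ℕ) (γ : YoungDiagram) : ℕ :=
  (γ.cells.filter (fun c => hookLen γ c.1 c.2 ≤ k)).card

/-- A `k`-bounded partition: all parts at most `k`. -/
def IsKBounded (k : ℕ) (lam : YoungDiagram) : Prop :=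
  ∀ i, lam.rowLen i ≤ k

/-- `𝔭(γ)`: the `k`-bounded partition obtained from a `(k+1)`-core `γ` by deleting every cell of
hook length greater than `k` and reading off row lengths. -/
noncomputable def pPart (k : ℕ) (γ : YoungDiagram) : YoungDiagram :=
  Classical.epsilon fun lam => ∀ i, lam.rowLen i = pRow k γ i

/-- `𝔠(λ)`: the unique `(k+1)`-core corresponding to the `k`-bounded partition `λ` under the
bijection `𝔭`. -/
noncomputable def coreOf (k : ℕ) (lam : YoungDiagram) : YoungDiagram :=
  Classical.epsilon fun γ => IsCore (k + 1) γ ∧ ∀ i, pRow k γ i = lam.rowLen i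

/-- The `k`-conjugate `λ^{ω_k} = 𝔭(𝔠(λ)')` of a `k`-bounded partition. -/
noncomputable def kConj (k : ℕ) (lam : YoungDiagram) : YoungDiagram :=
  pPart k ((coreOf k lam).transpose)

/-- A `k`-bounded composition: a list of parts, each between `1` and `k`. -/
def IsKBoundedComp (k : ℕ) (α : List ℕ) : Prop :=
  ∀ a ∈ α, 1 ≤ a ∧ a ≤ k

/-- Dominance order on partitions. -/
def Dominates (mu lam : YoungDiagram) : Prop :=
  mu.card = lam.card ∧
    ∀ n : ℕ, ∑ i ∈ Finset.range n, lam.rowLen i ≤ ∑ i ∈ Finset.range n, mu.rowLen i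


/-! ## Set-valued fillings and affine set-valued tableaux -/

/-- A set-valued filling of the shape `γ`: each cell of `γ` carries a finite nonempty set of
positive integers, empty outside `γ`, with `max X < min Y` when `X` is directly below `Y` and
`max X ≤ min Y` when `X` is directly to the left of `Y`. -/
def IsSVFilling (γ : YoungDiagram) (e : ℕ × ℕ → Finset ℕ) : Prop :=
  (∀ c : ℕ × ℕ, c ∈ γ ↔ (e c).Nonempty) ∧
  (∀ c : ℕ × ℕ, ∀ x ∈ e c, 0 < x) ∧
  (∀ r c : ℕ, ∀ x ∈ e (r, c), ∀ y ∈ e (r + 1, c), x < y) ∧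
  (∀ r c : ℕ, ∀ x ∈ e (r, c), ∀ y ∈ e (r, c + 1), x ≤ y)

/-- The set of cells of `T_{≤ x}`: cells containing a letter `≤ x`. -/
noncomputable def shapeLe (γ : YoungDiagram) (e : ℕ × ℕ → Finset ℕ) (x : ℕ) : Finset (ℕ × ℕ) :=
  γ.cells.filter fun c => ∃ y ∈ e c, y ≤ x

/-- A standard affine set-valued tableau of degree `n` and shape `γ`: a set-valued filling with
letters `1, …, n` such that for each `x`, the shape of `T_{≤x}` is a `(k+1)`-core and the letter
`x` occupies exactly all of its removable corners of one single residue. -/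
def IsStdASVT (k n : ℕ) (γ : YoungDiagram) (e : ℕ × ℕ → Finset ℕ) : Prop :=
  IsSVFilling γ e ∧
  (∀ c : ℕ × ℕ, ∀ y ∈ e c, y ≤ n) ∧
  ∀ x : ℕ, 1 ≤ x → x ≤ n →
    ∃ δ : YoungDiagram, IsCore (k + 1) δ ∧ δ.cells = shapeLe γ e x ∧
      ∃ i : ZMod (k + 1), (∃ c, x ∈ e c) ∧
        ∀ c : ℕ × ℕ, x ∈ e c ↔ Removable δ c ∧ residue k c = i

/-- The alphabet `𝒜_{α,x} = {Σ^{x-1}α + 1, …, Σ^x α}`. -/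
def alphaBlock (α : List ℕ) (x : ℕ) : Finset ℕ :=
  Finset.Ioc ((α.take (x - 1)).sum) ((α.take x).sum)

/-- `c` is the lowest occurrence of the letter `y`. -/
def IsLowestOcc (e : ℕ × ℕ → Finset ℕ) (y : ℕ) (c : ℕ × ℕ) : Prop :=
  y ∈ e c ∧ ∀ d : ℕ × ℕ, y ∈ e d → c.1 ≤ d.1

/-- `a` comes strictly before `b` in the reading order (top to bottom, left to right;
higher rows of the Ferrers shape have larger first coordinate here). -/
def ReadBefore (a b : ℕ × ℕ) : Prop :=
  b.1 < a.1 ∨ (a.1 = b.1 ∧ a.2 < b.2)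

/-- An affine set-valued tableau of weight `α` and shape `γ`: a standard affine set-valued
tableau of degree `|α|` such that for each `x`, the lowest reading word in `𝒜_{α,x}` is
increasing, the letters of `𝒜_{α,x}` occupy exactly `α_x` distinct residues, and they form a
horizontal strip. -/
def IsASVT (k : ℕ) (α : List ℕ) (γ : YoungDiagram) (e : ℕ × ℕ → Finset ℕ) : Prop :=
  IsStdASVT k α.sum γ e ∧
  ∀ x : ℕ, 1 ≤ x → x ≤ α.length →
    (∀ y z : ℕ, y ∈ alphaBlock α x → z ∈ alphaBlock α x → y < z →
      ∀ cy cz : ℕ × ℕ, IsLowestOcc e y cy → IsLowestOcc e z cz → ReadBefore cy cz) ∧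
    (((γ.cells.filter fun c => ∃ y ∈ alphaBlock α x, y ∈ e c).image (residue k)).card
        = α.getD (x - 1) 0) ∧
    (∀ c d : ℕ × ℕ, (∃ y ∈ alphaBlock α x, y ∈ e c) → (∃ y ∈ alphaBlock α x, y ∈ e d) →
      c.2 = d.2 → c = d)

/-- `𝒦^{(k)}_{λα}`: the number of affine set-valued tableaux of shape `𝔠(λ)` and weight `α`. -/
noncomputable def Kcal (k : ℕ) (lam : YoungDiagram) (α : List ℕ) : ℕ :=
  Nat.card {e : ℕ × ℕ → Finset ℕ // IsASVT k α (coreOf k lam) e}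

/-- A `k`-tableau of shape `γ` and weight `α`: a semistandard filling with letters `1,…,ℓ(α)`
(recorded as `0` outside `γ`) in which the letter `i` occupies exactly `α_i` distinct residues. -/
def IsKTab (k : ℕ) (α : List ℕ) (γ : YoungDiagram) (u : ℕ × ℕ → ℕ) : Prop :=
  (∀ c : ℕ × ℕ, c ∈ γ ↔ u c ≠ 0) ∧
  (∀ c : ℕ × ℕ, u c ≤ α.length) ∧
  (∀ r c : ℕ, (r, c) ∈ γ → (r + 1, c) ∈ γ → u (r, c) < u (r + 1, c)) ∧
  (∀ r c : ℕ, (r, c) ∈ γ → (r, c + 1) ∈ γ → u (r, c) ≤ u (r, c + 1)) ∧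
  ∀ i : ℕ, 1 ≤ i → i ≤ α.length →
    ((γ.cells.filter fun c => u c = i).image (residue k)).card = α.getD (i - 1) 0

/-- `K^{(k)}_{λα}`: the number of `k`-tableaux of shape `𝔠(λ)` and weight `α`. -/
noncomputable def Kktab (k : ℕ) (lam : YoungDiagram) (α : List ℕ) : ℕ :=
  Nat.card {u : ℕ × ℕ → ℕ // IsKTab k α (coreOf k lam) u}

/-- A plain set-valued tableau of shape `λ` and weight `α`. -/
def IsSVT (α : List ℕ) (lam : YoungDiagram) (e : ℕ × ℕ → Finset ℕ) : Prop :=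
  IsSVFilling lam e ∧ (∀ c : ℕ × ℕ, ∀ x ∈ e c, x ≤ α.length) ∧
  ∀ i : ℕ, 1 ≤ i → i ≤ α.length →
    (lam.cells.filter fun c => i ∈ e c).card = α.getD (i - 1) 0

/-- `𝒦_{λα}`: the number of set-valued tableaux of shape `λ` and weight `α`. -/
noncomputable def KcalSV (lam : YoungDiagram) (α : List ℕ) : ℕ :=
  Nat.card {e : ℕ × ℕ → Finset ℕ // IsSVT α lam e}

/-- The position of row `r` on the edge sequence (Maya diagram) of `γ`. -/
def bead (γ : YoungDiagram) (r : ℕ) : ℤ := (γ.rowLen r : ℤ) - r - 1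

/-- The position of column `c` on the edge sequence of `γ`. -/
def gapPos (γ : YoungDiagram) (c : ℕ) : ℤ := (c : ℤ) - γ.colLen c

/-- The integer `z` is the position of some row of `γ`. -/
def IsBead (γ : YoungDiagram) (z : ℤ) : Prop := ∃ r, bead γ r = z

theorem isBead_bead (γ : YoungDiagram) (r : ℕ) : IsBead γ (bead γ r) := ⟨r, rfl⟩

theorem bead_strictAnti (γ : YoungDiagram) : StrictAnti (bead γ) := by
  intro a b h
  have := γ.rowLen_anti a b h.le
  simp only [bead]
  omega

theorem gapPos_strictMono (γ : YoungDiagram) : StrictMono (gapPos γ) := by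
  intro a b h
  have := γ.colLen_anti a b h.le
  simp only [gapPos]
  omega

theorem mem_iff_gapPos_lt_bead {γ : YoungDiagram} {r c : ℕ} :
    (r, c) ∈ γ ↔ gapPos γ c < bead γ r := by
  have h1 : (r, c) ∈ γ ↔ c < γ.rowLen r := YoungDiagram.mem_iff_lt_rowLen
  have h2 : (r, c) ∈ γ ↔ r < γ.colLen c := YoungDiagram.mem_iff_lt_colLen
  simp only [gapPos, bead]
  by_cases h : (r, c) ∈ γ
  · have := h1.1 h
    have := h2.1 h
    simp only [h, true_iff]
    omega
  · have h1' := mt h1.2 h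
    have h2' := mt h2.2 h
    simp only [h, false_iff]
    omega

theorem hookLen_eq {γ : YoungDiagram} {r c : ℕ} (h : (r, c) ∈ γ) :
    (hookLen γ r c : ℤ) = bead γ r - gapPos γ c := by
  have h1 := YoungDiagram.mem_iff_lt_rowLen.1 h
  have h2 := YoungDiagram.mem_iff_lt_colLen.1 h
  simp only [hookLen, gapPos, bead]
  omega

theorem not_isBead_gapPos (γ : YoungDiagram) (c : ℕ) : ¬ IsBead γ (gapPos γ c) := by
  rintro ⟨r, hr⟩
  have h1 : (r, c) ∈ γ ↔ c < γ.rowLen r := YoungDiagram.mem_iff_lt_rowLen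
  have h2 : (r, c) ∈ γ ↔ r < γ.colLen c := YoungDiagram.mem_iff_lt_colLen
  have h3 := h1.symm.trans h2
  simp only [gapPos, bead] at hr
  omega

theorem exists_gapPos_of_not_isBead {γ : YoungDiagram} {z : ℤ} (hz : ¬ IsBead γ z) :
    ∃ c, gapPos γ c = z := by
  have hex : ∃ r, bead γ r < z := by
    refine ⟨γ.rowLen 0 + z.natAbs, ?_⟩
    have := γ.rowLen_anti 0 (γ.rowLen 0 + z.natAbs) (Nat.zero_le _)
    simp only [bead]
    omega
  have hr := Nat.find_spec hex
  have hmin : ∀ s, s < Nat.find hex → ¬ bead γ s < z := fun s => Nat.find_min hex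
  generalize Nat.find hex = r at hr hmin
  have hnn : 0 ≤ z + r := by
    simp only [bead] at hr
    omega
  refine ⟨(z + r).toNat, ?_⟩
  have h1 : ¬ r < γ.colLen (z + r).toNat := by
    rw [← YoungDiagram.mem_iff_lt_colLen, YoungDiagram.mem_iff_lt_rowLen]
    simp only [bead] at hr
    omega
  have h2 : ∀ s, s < r → s < γ.colLen (z + r).toNat := by
    intro s hs
    rw [← YoungDiagram.mem_iff_lt_colLen]
    have hle : s ≤ r - 1 := by omega
    refine γ.up_left_mem hle le_rfl ?_
    rw [YoungDiagram.mem_iff_lt_rowLen]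
    have h3 := hmin (r - 1) (by omega)
    have h4 : bead γ (r - 1) ≠ z := fun h => hz ⟨_, h⟩
    simp only [bead] at h3 h4
    omega
  have h5 : γ.colLen (z + r).toNat = r := by
    rcases lt_trichotomy (γ.colLen (z + r).toNat) r with h | h | h
    · exact absurd (h2 _ h) (lt_irrefl _)
    · exact h
    · exact absurd h h1
  simp only [gapPos, h5]
  omega

theorem isCore_iff {p : ℕ} (hp : 1 ≤ p) {γ : YoungDiagram} :
    IsCore p γ ↔ ∀ z, IsBead γ z → IsBead γ (z - p) := by
  constructor
  · rintro h z ⟨r, rfl⟩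
    by_contra hn
    obtain ⟨c, hc⟩ := exists_gapPos_of_not_isBead hn
    have hm : (r, c) ∈ γ := by
      rw [mem_iff_gapPos_lt_bead]
      omega
    have := hookLen_eq hm
    exact h (r, c) hm (by simp only; omega)
  · rintro h ⟨r, c⟩ hm hh
    have := hookLen_eq hm
    simp only at hh
    apply not_isBead_gapPos γ c
    have h2 := h _ (isBead_bead γ r)
    have h3 : gapPos γ c = bead γ r - p := by omega
    rwa [h3]

theorem pRow_eq (k : ℕ) (γ : YoungDiagram) (r : ℕ) :
    pRow k γ r = ((Finset.Ico (bead γ r - k) (bead γ r)).filter fun z => ¬ IsBead γ z).card := by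
  unfold pRow
  refine Finset.card_bij (fun c _ => gapPos γ c.2) ?_ ?_ ?_
  · rintro ⟨s, c⟩ h
    simp only [Finset.mem_filter, YoungDiagram.mem_cells] at h
    obtain ⟨hm, rfl, hk⟩ := h
    have := hookLen_eq hm
    have := mem_iff_gapPos_lt_bead.1 hm
    simp only [Finset.mem_filter, Finset.mem_Ico]
    exact ⟨by omega, not_isBead_gapPos γ c⟩
  · rintro ⟨s, c⟩ h ⟨s', c'⟩ h' heq
    simp only [Finset.mem_filter, YoungDiagram.mem_cells] at h h'
    have := (gapPos_strictMono γ).injective heq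
    simp only at this
    simp [h.2.1, h'.2.1, this]
  · intro z hz
    simp only [Finset.mem_filter, Finset.mem_Ico] at hz
    obtain ⟨c, rfl⟩ := exists_gapPos_of_not_isBead hz.2
    have hm : (r, c) ∈ γ := mem_iff_gapPos_lt_bead.2 hz.1.2
    have := hookLen_eq hm
    refine ⟨(r, c), ?_, rfl⟩
    simp only [Finset.mem_filter, YoungDiagram.mem_cells]
    exact ⟨hm, trivial, by omega⟩

theorem pRow_le_rowLen (k : ℕ) (γ : YoungDiagram) (r : ℕ) : pRow k γ r ≤ γ.rowLen r := by
  rw [YoungDiagram.rowLen_eq_card]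
  refine Finset.card_le_card fun c hc => ?_
  simp only [Finset.mem_filter, YoungDiagram.mem_cells] at hc
  exact YoungDiagram.mem_row_iff.2 ⟨hc.1, hc.2.1⟩

theorem IsCore.isBead_of_le {k : ℕ} {γ : YoungDiagram} (h : IsCore (k + 1) γ) {z w : ℤ}
    (hzw : (z : ZMod (k + 1)) = w) (hle : z ≤ w) (hw : IsBead γ w) : IsBead γ z := by
  rw [isCore_iff (by omega)] at h
  obtain ⟨t, ht⟩ := (ZMod.intCast_eq_intCast_iff_dvd_sub z w (k + 1)).1 hzw
  have ht0 : 0 ≤ t := by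
    by_contra hn
    have : (((k + 1 : ℕ) : ℤ)) * t < 0 := mul_neg_of_pos_of_neg (by positivity) (by omega)
    omega
  lift t to ℕ using ht0
  have key : ∀ n : ℕ, IsBead γ (w - ((k + 1 : ℕ) : ℤ) * n) := by
    intro n
    induction n with
    | zero => simpa using hw
    | succ n ih =>
      have := h _ ih
      convert this using 1
      push_cast
      ring
  have := key t
  rwa [← ht, sub_sub_cancel] at this

theorem residue_eq (k r c : ℕ) : residue k (r, c) = (((c : ℤ) - r : ℤ) : ZMod (k + 1)) := by
  simp [residue]

theorem removable_iff {γ : YoungDiagram} {r c : ℕ} :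
    Removable γ (r, c) ↔ γ.rowLen r = c + 1 ∧ ¬ IsBead γ (bead γ r - 1) := by
  simp only [Removable, YoungDiagram.mem_iff_lt_rowLen]
  constructor
  · rintro ⟨h1, h2, h3⟩
    refine ⟨by omega, ?_⟩
    rintro ⟨s, hs⟩
    have hlt : r < s := (bead_strictAnti γ).lt_iff_gt.1 (by omega)
    have := (bead_strictAnti γ).antitone (show r + 1 ≤ s from hlt)
    simp only [bead] at *
    omega
  · rintro ⟨h1, h2⟩
    refine ⟨by omega, ?_, by omega⟩
    intro h3
    have := γ.rowLen_anti r (r + 1) (by omega)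
    apply h2
    refine ⟨r + 1, ?_⟩
    simp only [bead]
    omega

theorem addable_iff {γ : YoungDiagram} {r c : ℕ} :
    Addable γ (r, c) ↔ γ.rowLen r = c ∧ ¬ IsBead γ (bead γ r + 1) := by
  constructor
  · rintro ⟨h1, h2⟩
    have hc : γ.rowLen r = c := by
      rw [YoungDiagram.mem_iff_lt_rowLen] at h1
      rcases Nat.eq_zero_or_pos c with rfl | hc
      · omega
      · have := h2 (r, c - 1) (by simp) (by simp; omega)
        rw [YoungDiagram.mem_iff_lt_rowLen] at this
        omega
    refine ⟨hc, ?_⟩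
    rintro ⟨s, hs⟩
    have hlt : s < r := (bead_strictAnti γ).lt_iff_gt.1 (by omega)
    have := h2 (s, c) (by simp [Prod.le_def]; omega) (by simp; omega)
    rw [YoungDiagram.mem_iff_lt_rowLen] at this
    simp only [bead] at hs
    omega
  · rintro ⟨h1, h2⟩
    refine ⟨by rw [YoungDiagram.mem_iff_lt_rowLen]; omega, ?_⟩
    rintro ⟨s, d⟩ hle hne
    obtain ⟨hs, hd⟩ : s ≤ r ∧ d ≤ c := hle
    rcases hs.lt_or_eq with hs | rfl
    · refine γ.up_left_mem (show s ≤ r - 1 by omega) hd ?_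
      rw [YoungDiagram.mem_iff_lt_rowLen]
      have := γ.rowLen_anti (r - 1) r (by omega)
      by_contra hn
      apply h2
      refine ⟨r - 1, ?_⟩
      simp only [bead]
      omega
    · rw [YoungDiagram.mem_iff_lt_rowLen]
      have : d ≠ c := fun h => hne (by rw [h])
      omega

theorem eq_of_rowLen_eq {γ δ : YoungDiagram} (h : ∀ r, γ.rowLen r = δ.rowLen r) : γ = δ := by
  ext ⟨r, c⟩
  simp only [YoungDiagram.mem_cells, YoungDiagram.mem_iff_lt_rowLen, h]

/-- `δ'` is obtained from `δ` by adding cells which are removable corners of `δ'` of residue `i`. -/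
def IsStep (k : ℕ) (i : ZMod (k + 1)) (δ δ' : YoungDiagram) : Prop :=
  δ ≤ δ' ∧ ∀ c ∈ δ', c ∉ δ → Removable δ' c ∧ residue k c = i

namespace IsStep

variable {k : ℕ} {i : ZMod (k + 1)} {δ δ' : YoungDiagram}

theorem bead_cases (h : IsStep k i δ δ') (r : ℕ) :
    bead δ' r = bead δ r ∨
      (bead δ' r = bead δ r + 1 ∧ ((bead δ r + 1 : ℤ) : ZMod (k + 1)) = i ∧
        ¬ IsBead δ' (bead δ r)) := by
  by_cases hm : (r, δ.rowLen r) ∈ δ'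
  · right
    obtain ⟨h1, h2⟩ := h.2 _ hm (by rw [YoungDiagram.mem_iff_lt_rowLen]; omega)
    rw [removable_iff] at h1
    rw [residue_eq] at h2
    have h3 : bead δ' r = bead δ r + 1 := by
      simp only [bead, h1.1]
      omega
    refine ⟨h3, ?_, ?_⟩
    · rw [← h2]
      congr 1
      simp only [bead]
      omega
    · have h4 := h1.2
      rwa [h3, add_sub_cancel_right] at h4
  · left
    rw [YoungDiagram.mem_iff_lt_rowLen] at hm
    have : δ.rowLen r ≤ δ'.rowLen r := by
      by_contra hn
      have h1 : (r, δ'.rowLen r) ∈ δ := by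
        rw [YoungDiagram.mem_iff_lt_rowLen]
        omega
      have h2 := h.1 h1
      rw [YoungDiagram.mem_iff_lt_rowLen] at h2
      omega
    simp only [bead]
    omega

theorem not_isBead_add_one (hk : 1 ≤ k) (h : IsStep k i δ δ') {r : ℕ}
    (hr : bead δ' r = bead δ r + 1) : ¬ IsBead δ (bead δ r + 1) := by
  have : Fact (1 < k + 1) := ⟨by omega⟩
  rintro ⟨s, hs⟩
  have hlt : s < r := (bead_strictAnti δ).lt_iff_gt.1 (by omega)
  have hlt' := bead_strictAnti δ' hlt
  rcases h.bead_cases r with h1 | ⟨-, h1, -⟩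
  · omega
  rcases h.bead_cases s with h2 | ⟨-, h2, -⟩
  · omega
  rw [hs] at h2
  push_cast at h1 h2
  rw [h1] at h2
  simp at h2

theorem isBead_iff_of_ne (h : IsStep k i δ δ') {z : ℤ} (hz : (z : ZMod (k + 1)) ≠ i)
    (hz' : ((z + 1 : ℤ) : ZMod (k + 1)) ≠ i) : IsBead δ' z ↔ IsBead δ z := by
  constructor
  · rintro ⟨r, rfl⟩
    rcases h.bead_cases r with h1 | ⟨h1, h2, -⟩
    · exact ⟨r, h1.symm⟩
    · rw [h1] at hz
      exact absurd h2 hz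
  · rintro ⟨r, rfl⟩
    rcases h.bead_cases r with h1 | ⟨h1, h2, -⟩
    · exact ⟨r, h1⟩
    · exact absurd h2 hz'

theorem isBead_swap (hk : 1 ≤ k) (h : IsStep k i δ δ') (hδ : IsCore (k + 1) δ)
    (hδ' : IsCore (k + 1) δ') {R : ℕ} (hR : bead δ' R = bead δ R + 1) {z : ℤ}
    (hz : ((z + 1 : ℤ) : ZMod (k + 1)) = i) :
    (IsBead δ' z ↔ IsBead δ (z + 1)) ∧ (IsBead δ' (z + 1) ↔ IsBead δ z) := by
  have : Fact (1 < k + 1) := ⟨by omega⟩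
  by_cases hm : ∃ r, bead δ r = z ∧ bead δ' r = z + 1
  · obtain ⟨r, hr, hr'⟩ := hm
    have h1 := h.not_isBead_add_one hk (r := r) (by omega)
    rw [hr] at h1
    have h2 : ¬ IsBead δ' z := by
      rcases h.bead_cases r with h2 | ⟨-, -, h2⟩
      · omega
      · rwa [hr] at h2
    exact ⟨iff_of_false h2 h1, iff_of_true ⟨r, hr'⟩ ⟨r, hr⟩⟩
  have e1 : IsBead δ' z ↔ IsBead δ z := by
    constructor
    · rintro ⟨r, hr⟩
      rcases h.bead_cases r with h1 | ⟨h1, h2, -⟩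
      · exact ⟨r, by omega⟩
      · rw [show bead δ r + 1 = z by omega] at h2
        push_cast at hz
        rw [h2] at hz
        simp at hz
    · rintro ⟨r, hr⟩
      rcases h.bead_cases r with h1 | ⟨h1, h2, -⟩
      · exact ⟨r, by omega⟩
      · exact absurd ⟨r, hr, by omega⟩ hm
  have e2 : IsBead δ' (z + 1) ↔ IsBead δ (z + 1) := by
    constructor
    · rintro ⟨r, hr⟩
      rcases h.bead_cases r with h1 | ⟨h1, h2, -⟩
      · exact ⟨r, by omega⟩
      · exact absurd ⟨r, by omega, by omega⟩ hm
    · rintro ⟨r, hr⟩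
      rcases h.bead_cases r with h1 | ⟨h1, h2, -⟩
      · exact ⟨r, by omega⟩
      · rw [show bead δ r + 1 = (z + 1) + 1 by omega] at h2
        rw [Int.cast_add, hz] at h2
        simp at h2
  obtain ⟨hc, hn⟩ : ((bead δ R + 1 : ℤ) : ZMod (k + 1)) = i ∧ ¬ IsBead δ' (bead δ R) := by
    rcases h.bead_cases R with h1 | ⟨-, h1⟩
    · omega
    · exact h1
  have hn1 := h.not_isBead_add_one hk hR
  have hres1 : ((z + 1 : ℤ) : ZMod (k + 1)) = ((bead δ R + 1 : ℤ) : ZMod (k + 1)) := by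
    rw [hz, hc]
  have hres : (z : ZMod (k + 1)) = (bead δ R : ZMod (k + 1)) := by
    push_cast at hres1
    exact add_right_cancel hres1
  rcases le_total (bead δ R) z with hle | hle
  · have f1 : ¬ IsBead δ (z + 1) := fun hb =>
      hn1 (hδ.isBead_of_le hres1.symm (by omega) hb)
    have f2 : ¬ IsBead δ' z := fun hb => hn (hδ'.isBead_of_le hres.symm hle hb)
    have f3 : ¬ IsBead δ z := mt e1.2 f2
    have f4 : ¬ IsBead δ' (z + 1) := mt e2.1 f1
    exact ⟨iff_of_false f2 f1, iff_of_false f4 f3⟩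
  · have f1 : IsBead δ z := hδ.isBead_of_le hres hle (isBead_bead δ R)
    have f2 : IsBead δ' (z + 1) :=
      hδ'.isBead_of_le hres1 (by omega) (hR ▸ isBead_bead δ' R)
    exact ⟨iff_of_true (e1.2 f1) (e2.1 f2), iff_of_true f2 f1⟩

end IsStep

theorem Ico_eq_insert_left {a b : ℤ} (h : a < b) :
    Finset.Ico a b = insert a (Finset.Ico (a + 1) b) := by
  ext x
  simp only [Finset.mem_Ico, Finset.mem_insert]
  omega

theorem Ico_eq_insert_right {a b : ℤ} (h : a ≤ b) :
    Finset.Ico a (b + 1) = insert b (Finset.Ico a b) := by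
  ext x
  simp only [Finset.mem_Ico, Finset.mem_insert]
  omega

theorem card_filter_insert {P : ℤ → Prop} [DecidablePred P] {s : Finset ℤ} {a : ℤ} (ha : a ∉ s) :
    ((insert a s).filter P).card = (s.filter P).card + if P a then 1 else 0 := by
  rw [Finset.filter_insert]
  split_ifs with h
  · rw [Finset.card_insert_of_notMem (by simp [ha])]
  · rfl

theorem intCast_ne_of_lt {k : ℕ} {a b : ℤ} (h1 : a < b) (h2 : b ≤ a + k) :
    (a : ZMod (k + 1)) ≠ (b : ZMod (k + 1)) := by
  intro h
  have hd := (ZMod.intCast_eq_intCast_iff_dvd_sub a b (k + 1)).1 h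
  have := Int.le_of_dvd (by omega) hd
  push_cast at this
  omega

/-- Along a step between two cores, only the part in the highest row with a new cell grows. -/
theorem IsStep.pRow_eq {k : ℕ} {i : ZMod (k + 1)} {δ δ' : YoungDiagram} (hk : 1 ≤ k)
    (h : IsStep k i δ δ') (hδ : IsCore (k + 1) δ)
    (hδ' : IsCore (k + 1) δ') {R : ℕ} (hR : bead δ' R = bead δ R + 1)
    (htop : ∀ r, R < r → bead δ' r = bead δ r) (r : ℕ) :
    pRow k δ' r = pRow k δ r + if r = R then 1 else 0 := by
  have cast_succ : ∀ {a b : ℤ}, (a : ZMod (k + 1)) = b ↔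
      ((a + 1 : ℤ) : ZMod (k + 1)) = ((b + 1 : ℤ) : ZMod (k + 1)) := by
    intro a b
    push_cast
    simp
  have hper : ∀ a : ℤ, ((a - k : ℤ) : ZMod (k + 1)) = ((a + 1 : ℤ) : ZMod (k + 1)) := by
    intro a
    rw [ZMod.intCast_eq_intCast_iff_dvd_sub]
    exact ⟨1, by push_cast; ring⟩
  have hcore : ∀ a : ℤ, IsBead δ a → IsBead δ (a - k - 1) := fun a ha =>
    hδ.isBead_of_le (by rw [cast_succ, sub_add_cancel, hper]) (by omega) ha
  have hci : ((bead δ R + 1 : ℤ) : ZMod (k + 1)) = i := by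
    rcases h.bead_cases R with h1 | ⟨-, h1, -⟩
    · omega
    · exact h1
  rw [AffineKTheory.pRow_eq, AffineKTheory.pRow_eq]
  have mid : ∀ s : Finset ℤ, (∀ z ∈ s, (z : ZMod (k + 1)) ≠ i ∧
      ((z + 1 : ℤ) : ZMod (k + 1)) ≠ i) →
      (s.filter fun z => ¬ IsBead δ' z) = s.filter fun z => ¬ IsBead δ z := by
    intro s hs
    refine Finset.filter_congr fun z hz => not_congr ?_
    exact h.isBead_iff_of_ne (hs z hz).1 (hs z hz).2
  by_cases hb1 : ((bead δ r + 1 : ℤ) : ZMod (k + 1)) = i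
  · have hmid := mid (Finset.Ico (bead δ r - k + 1) (bead δ r)) fun z hz => by
      rw [Finset.mem_Ico] at hz
      rw [← hb1]
      exact ⟨intCast_ne_of_lt (by omega) (by omega), intCast_ne_of_lt (by omega) (by omega)⟩
    have hswapk := h.isBead_swap hk hδ hδ' hR (z := bead δ r - k - 1) (by
      rw [sub_add_cancel, hper, hb1])
    rw [sub_add_cancel] at hswapk
    rcases h.bead_cases r with h1 | ⟨h1, h2, h3⟩
    · have hne : r ≠ R := by
        rintro rfl
        omega
      rw [h1, if_neg hne, Ico_eq_insert_left (by omega), card_filter_insert (by simp),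
        card_filter_insert (by simp), hmid]
      have hb' : IsBead δ' (bead δ r) := ⟨r, h1⟩
      have hb : IsBead δ (bead δ r + 1) := (h.isBead_swap hk hδ hδ' hR hb1).1.1 hb'
      have e1 : IsBead δ (bead δ r - k) := hδ.isBead_of_le (hper _) (by omega) hb
      have e2 : IsBead δ' (bead δ r - k) := hswapk.2.2 (hcore _ (isBead_bead δ r))
      simp [e1, e2]
    · rw [h1, show bead δ r + 1 - k = bead δ r - k + 1 by ring,
        Ico_eq_insert_right (by omega), card_filter_insert (by simp),
        Ico_eq_insert_left (show bead δ r - k < bead δ r by omega), card_filter_insert (by simp),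
        hmid, if_pos h3]
      have hRr : r ≤ R := by
        by_contra hn
        have := htop r (by omega)
        omega
      rcases hRr.lt_or_eq with hlt | rfl
      · have hne : r ≠ R := hlt.ne
        have hlt' := bead_strictAnti δ hlt
        have hn : ¬ IsBead δ (bead δ r - k) := by
          intro hb
          apply h.not_isBead_add_one hk hR
          refine hδ.isBead_of_le ?_ ?_ hb
          · rw [hper, hb1, hci]
          · by_contra hc
            exact intCast_ne_of_lt (k := k) hlt' (by omega) (by rw [cast_succ, hb1, hci])
        simp [hn, hne]
      · have hb : IsBead δ (bead δ r - k) := by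
          rw [← hswapk.1]
          obtain ⟨s, hs⟩ := hcore _ (isBead_bead δ r)
          have hlt : r < s := (bead_strictAnti δ).lt_iff_gt.1 (by omega)
          exact ⟨s, (htop s hlt).trans hs⟩
        simp [hb]
  · have h1 : bead δ' r = bead δ r := by
      rcases h.bead_cases r with h1 | ⟨-, h1, -⟩
      · exact h1
      · exact absurd h1 hb1
    have hne : r ≠ R := by
      rintro rfl
      omega
    rw [h1, if_neg hne, add_zero]
    by_cases hb : (bead δ r : ZMod (k + 1)) = i
    · have hmid := mid (Finset.Ico (bead δ r - k) (bead δ r - 1)) fun z hz => by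
        rw [Finset.mem_Ico] at hz
        rw [← hb]
        exact ⟨intCast_ne_of_lt (by omega) (by omega), intCast_ne_of_lt (by omega) (by omega)⟩
      have hsw := h.isBead_swap hk hδ hδ' hR (z := bead δ r - 1) (by rw [sub_add_cancel, hb])
      rw [sub_add_cancel] at hsw
      have e1 : IsBead δ' (bead δ r - 1) := hsw.1.2 (isBead_bead δ r)
      have e2 : IsBead δ (bead δ r - 1) := hsw.2.1 ⟨r, h1⟩
      have hico : Finset.Ico (bead δ r - k) (bead δ r) =
          insert (bead δ r - 1) (Finset.Ico (bead δ r - k) (bead δ r - 1)) := by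
        rw [← Ico_eq_insert_right (by omega), sub_add_cancel]
      rw [hico, card_filter_insert (by simp), card_filter_insert (by simp), hmid]
      simp [e1, e2]
    · let s : ℤ → ℤ := fun z => if ((z + 1 : ℤ) : ZMod (k + 1)) = i then z + 1
        else if (z : ZMod (k + 1)) = i then z - 1 else z
      have : Fact (1 < k + 1) := ⟨by omega⟩
      have hs1 : ∀ z : ℤ, ((z + 1 : ℤ) : ZMod (k + 1)) = i → s z = z + 1 := fun z hz => by
        simp only [s]; rw [if_pos hz]
      have hs2 : ∀ z : ℤ, (z : ZMod (k + 1)) = i → s z = z - 1 := fun z hz => by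
        simp only [s]
        rw [if_neg, if_pos hz]
        rw [Int.cast_add, hz]
        simp
      have hs3 : ∀ z : ℤ, (z : ZMod (k + 1)) ≠ i → ((z + 1 : ℤ) : ZMod (k + 1)) ≠ i →
          s z = z := fun z hz hz' => by
        simp only [s]
        rw [if_neg hz', if_neg hz]
      have hss : ∀ z, s (s z) = z := by
        intro z
        by_cases h1 : ((z + 1 : ℤ) : ZMod (k + 1)) = i
        · rw [hs1 z h1, hs2 _ h1]; ring
        · by_cases h2 : (z : ZMod (k + 1)) = i
          · rw [hs2 z h2, hs1 _ (by rwa [sub_add_cancel])]; ring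
          · rw [hs3 z h2 h1, hs3 z h2 h1]
      have hsB : ∀ z, IsBead δ' (s z) ↔ IsBead δ z := by
        intro z
        by_cases h1 : ((z + 1 : ℤ) : ZMod (k + 1)) = i
        · rw [hs1 z h1]
          exact (h.isBead_swap hk hδ hδ' hR h1).2
        · by_cases h2 : (z : ZMod (k + 1)) = i
          · rw [hs2 z h2]
            have := (h.isBead_swap hk hδ hδ' hR (z := z - 1) (by rwa [sub_add_cancel])).1
            rwa [sub_add_cancel] at this
          · rw [hs3 z h2 h1]
            exact h.isBead_iff_of_ne h2 h1
      have hsI : ∀ z ∈ Finset.Ico (bead δ r - k) (bead δ r),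
          s z ∈ Finset.Ico (bead δ r - k) (bead δ r) := by
        intro z hz
        rw [Finset.mem_Ico] at hz ⊢
        by_cases h1 : ((z + 1 : ℤ) : ZMod (k + 1)) = i
        · rw [hs1 z h1]
          have : z + 1 ≠ bead δ r := by
            intro he
            rw [he] at h1
            exact hb h1
          omega
        · by_cases h2 : (z : ZMod (k + 1)) = i
          · rw [hs2 z h2]
            have : z ≠ bead δ r - k := by
              rintro rfl
              rw [hper] at h2
              exact hb1 h2
            omega
          · rw [hs3 z h2 h1]
            exact hz
      refine Finset.card_nbij' s s ?_ ?_ (fun z _ => hss z) (fun z _ => hss z)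
      · intro z hz
        simp only [Finset.coe_filter, Set.mem_ofPred_eq] at hz ⊢
        refine ⟨hsI z hz.1, ?_⟩
        rw [← hsB, hss]
        exact hz.2
      · intro z hz
        simp only [Finset.coe_filter, Set.mem_ofPred_eq] at hz ⊢
        refine ⟨hsI z hz.1, ?_⟩
        rw [hsB]
        exact hz.2

theorem IsCore.not_addable_and_removable {k : ℕ} {γ : YoungDiagram} (h : IsCore (k + 1) γ)
    {z w : ℤ} (hzw : (z : ZMod (k + 1)) = ((w + 1 : ℤ) : ZMod (k + 1))) (hz : IsBead γ z)
    (hz' : ¬ IsBead γ (z - 1)) (hw : IsBead γ w) (hw' : ¬ IsBead γ (w + 1)) : False := by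
  rcases le_total z w with hle | hle
  · refine hz' (h.isBead_of_le ?_ (by omega) hw)
    rw [Int.cast_sub, hzw]
    push_cast
    ring
  · rcases hle.lt_or_eq with hlt | rfl
    · exact hw' (h.isBead_of_le hzw.symm (by omega) hz)
    · refine hz' (h.isBead_of_le ?_ (by omega) hz)
      rw [Int.cast_sub]
      nth_rw 1 [hzw]
      push_cast
      ring

theorem isCore_bot (p : ℕ) : IsCore p ⊥ := fun c hc => absurd hc (YoungDiagram.notMem_bot c)

theorem rowLen_eq_zero {γ : YoungDiagram} {r : ℕ} (h : γ.colLen 0 ≤ r) : γ.rowLen r = 0 := by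
  by_contra hn
  have : (r, 0) ∈ γ := by
    rw [YoungDiagram.mem_iff_lt_rowLen]
    omega
  rw [YoungDiagram.mem_iff_lt_colLen] at this
  omega

theorem eq_of_bead_eq {γ δ : YoungDiagram} (h : ∀ r, bead γ r = bead δ r) : γ = δ := by
  refine eq_of_rowLen_eq fun r => ?_
  have := h r
  simp only [bead] at this
  omega

/-- If two diagrams differ then they differ in a highest row. -/
theorem exists_top_row_ne {γ δ : YoungDiagram} (hne : γ ≠ δ) :
    ∃ R, bead γ R ≠ bead δ R ∧ ∀ r, R < r → bead γ r = bead δ r := by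
  have hex : ∃ r, bead γ r ≠ bead δ r := by
    by_contra hn
    push Not at hn
    exact hne (eq_of_bead_eq hn)
  obtain ⟨r0, hr0⟩ := hex
  set N := γ.colLen 0 + δ.colLen 0
  have hN : ∀ r, bead γ r ≠ bead δ r → r ≤ N := by
    intro r hr
    by_contra hn
    apply hr
    simp only [bead]
    rw [rowLen_eq_zero (γ := γ) (by omega), rowLen_eq_zero (γ := δ) (by omega)]
  refine ⟨Nat.findGreatest (fun r => bead γ r ≠ bead δ r) N,
    Nat.findGreatest_spec (P := fun r => bead γ r ≠ bead δ r) (hN _ hr0) hr0, fun r hr => ?_⟩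
  by_contra hc
  exact Nat.findGreatest_is_greatest hr (hN _ hc) hc

theorem IsStep.exists_top {k : ℕ} {i : ZMod (k + 1)} {δ δ' : YoungDiagram} (hk : 1 ≤ k)
    (h : IsStep k i δ δ') (hδ : IsCore (k + 1) δ) (hδ' : IsCore (k + 1) δ') :
    ∃ T : Option ℕ, (∀ r, pRow k δ' r = pRow k δ r + if T = some r then 1 else 0) ∧
      ∀ R, T = some R → ∃ c, (R, c) ∈ δ' ∧ (R, c) ∉ δ := by
  by_cases heq : δ' = δ
  · exact ⟨none, by simp [heq], by simp⟩
  · obtain ⟨R, hR, htop⟩ := exists_top_row_ne heq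
    have hR' : bead δ' R = bead δ R + 1 := by
      rcases h.bead_cases R with h1 | ⟨h1, -⟩
      · exact absurd h1 hR
      · exact h1
    refine ⟨some R, fun r => ?_, ?_⟩
    · rw [h.pRow_eq hk hδ hδ' hR' htop r]
      simp only [Option.some.injEq, eq_comm]
    · intro R' hRR
      obtain rfl := Option.some.inj hRR
      refine ⟨δ.rowLen R, ?_, ?_⟩ <;> rw [YoungDiagram.mem_iff_lt_rowLen]
      · simp only [bead] at hR'
        omega
      · omega

theorem pRow_ne_of_bead_lt {k : ℕ} {γ δ : YoungDiagram} (hδ : IsCore (k + 1) δ) {r : ℕ}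
    (hlt : bead γ r < bead δ r) (htop : ∀ s, r < s → bead γ s = bead δ s) :
    pRow k γ r ≠ pRow k δ r := by
  have hU : ∀ (ε : YoungDiagram), (∀ s, r < s → bead γ s = bead ε s) →
      pRow k ε r + ((Finset.Ico (bead ε r - k) (bead ε r)).filter
        fun z => ∃ s, r < s ∧ bead γ s = z).card = k := by
    intro ε hε
    rw [pRow_eq]
    have : ((Finset.Ico (bead ε r - k) (bead ε r)).filter fun z => ∃ s, r < s ∧ bead γ s = z) =
        (Finset.Ico (bead ε r - k) (bead ε r)).filter fun z => IsBead ε z := by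
      refine Finset.filter_congr fun z hz => ?_
      rw [Finset.mem_Ico] at hz
      constructor
      · rintro ⟨s, hs, rfl⟩
        exact ⟨s, (hε s hs).symm⟩
      · rintro ⟨s, rfl⟩
        have hs : r < s := (bead_strictAnti ε).lt_iff_gt.1 (by omega)
        exact ⟨s, hs, hε s hs⟩
    rw [this, add_comm, Finset.card_filter_add_card_filter_not]
    simp
  have h1 := hU γ fun _ _ => rfl
  have h2 := hU δ htop
  have h3 : ((Finset.Ico (bead δ r - k) (bead δ r)).filter
      fun z => ∃ s, r < s ∧ bead γ s = z).card <
      ((Finset.Ico (bead γ r - k) (bead γ r)).filter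
      fun z => ∃ s, r < s ∧ bead γ s = z).card := by
    apply Finset.card_lt_card
    rw [Finset.ssubset_iff_of_subset]
    · rw [isCore_iff (by omega)] at hδ
      obtain ⟨t, ht⟩ := hδ _ (isBead_bead δ r)
      push_cast at ht
      have hrt : r < t := (bead_strictAnti δ).lt_iff_gt.1 (by omega)
      have hlt' := bead_strictAnti γ hrt
      have := htop t hrt
      refine ⟨bead γ t, ?_, ?_⟩
      · simp only [Finset.mem_filter, Finset.mem_Ico]
        exact ⟨by omega, t, hrt, rfl⟩
      · simp only [Finset.mem_filter, Finset.mem_Ico]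
        omega
    · intro z
      simp only [Finset.mem_filter, Finset.mem_Ico]
      rintro ⟨hz, s, hs, rfl⟩
      have := bead_strictAnti γ hs
      exact ⟨by omega, s, hs, rfl⟩
  omega

/-- A core is determined by its `k`-bounded partition. -/
theorem eq_of_pRow_eq {k : ℕ} {γ δ : YoungDiagram} (hγ : IsCore (k + 1) γ)
    (hδ : IsCore (k + 1) δ) (h : ∀ r, pRow k γ r = pRow k δ r) : γ = δ := by
  by_contra hne
  obtain ⟨R, hR, htop⟩ := exists_top_row_ne hne
  rcases lt_or_gt_of_ne hR with hlt | hlt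
  · exact pRow_ne_of_bead_lt hδ hlt htop (h R)
  · exact pRow_ne_of_bead_lt hγ hlt (fun s hs => (htop s hs).symm) (h R).symm

/-- The diagram obtained from `δ` by adding all addable corners of residue `i`. -/
noncomputable def addCorners (k : ℕ) (i : ZMod (k + 1)) (δ : YoungDiagram) : YoungDiagram where
  cells := δ.cells ∪ ((Finset.range (δ.colLen 0 + 1)).image fun r => (r, δ.rowLen r)).filter
    fun c => Addable δ c ∧ residue k c = i
  isLowerSet := by
    intro c d hdc hc
    simp only [Finset.coe_union, Set.mem_union, Finset.mem_coe, YoungDiagram.mem_cells,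
      Finset.mem_filter] at hc ⊢
    rcases hc with hc | hc
    · exact Or.inl (δ.isLowerSet hdc hc)
    · by_cases hd : d = c
      · exact Or.inr (hd ▸ hc)
      · exact Or.inl (hc.2.1.2 d hdc hd)

theorem mem_addCorners {k : ℕ} {i : ZMod (k + 1)} {δ : YoungDiagram} {c : ℕ × ℕ} :
    c ∈ addCorners k i δ ↔ c ∈ δ ∨ (Addable δ c ∧ residue k c = i) := by
  rw [← YoungDiagram.mem_cells]
  simp only [addCorners, Finset.mem_union, YoungDiagram.mem_cells, Finset.mem_filter]
  refine or_congr_right (and_iff_right_of_imp fun h => ?_)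
  obtain ⟨r, c⟩ := c
  have h1 := addable_iff.1 h.1
  rw [Finset.mem_image]
  refine ⟨r, ?_, by rw [h1.1]⟩
  rw [Finset.mem_range]
  rcases Nat.eq_zero_or_pos r with rfl | hr
  · omega
  · have := h.1.2 (r - 1, 0) (by simp [Prod.le_def]) (by simp; omega)
    rw [YoungDiagram.mem_iff_lt_colLen] at this
    omega

theorem isStep_addCorners (k : ℕ) (i : ZMod (k + 1)) (δ : YoungDiagram) :
    IsStep k i δ (addCorners k i δ) := by
  refine ⟨fun c hc => mem_addCorners.2 (Or.inl hc), ?_⟩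
  rintro ⟨r, c⟩ hc hn
  have h := (mem_addCorners.1 hc).resolve_left hn
  have h1 := addable_iff.1 h.1
  refine ⟨⟨hc, fun h2 => ?_, fun h2 => ?_⟩, h.2⟩
  · rcases mem_addCorners.1 h2 with h2 | h2
    · exact hn (δ.up_left_mem (Nat.le_succ r) le_rfl h2)
    · exact hn (h2.1.2 (r, c) (by simp [Prod.le_def]) (by simp))
  · rcases mem_addCorners.1 h2 with h2 | h2
    · exact hn (δ.up_left_mem le_rfl (Nat.le_succ c) h2)
    · exact hn (h2.1.2 (r, c) (by simp [Prod.le_def]) (by simp))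

theorem bead_addCorners (k : ℕ) (i : ZMod (k + 1)) (δ : YoungDiagram) (r : ℕ) :
    (bead (addCorners k i δ) r = bead δ r ∧
      ¬ (¬ IsBead δ (bead δ r + 1) ∧ ((bead δ r + 1 : ℤ) : ZMod (k + 1)) = i)) ∨
    (bead (addCorners k i δ) r = bead δ r + 1 ∧
      ¬ IsBead δ (bead δ r + 1) ∧ ((bead δ r + 1 : ℤ) : ZMod (k + 1)) = i) := by
  have hm : (r, δ.rowLen r) ∈ addCorners k i δ ↔
      ¬ IsBead δ (bead δ r + 1) ∧ ((bead δ r + 1 : ℤ) : ZMod (k + 1)) = i := by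
    rw [mem_addCorners, addable_iff, residue_eq, YoungDiagram.mem_iff_lt_rowLen]
    have : bead δ r + 1 = (δ.rowLen r : ℤ) - r := by
      simp only [bead]
      omega
    simp [this]
  rw [← hm, YoungDiagram.mem_iff_lt_rowLen]
  rcases (isStep_addCorners k i δ).bead_cases r with h | ⟨h, -⟩
  · exact Or.inl ⟨h, by simp only [bead] at h; omega⟩
  · exact Or.inr ⟨h, by simp only [bead] at h; omega⟩

theorem isCore_addCorners {k : ℕ} (hk : 1 ≤ k) (i : ZMod (k + 1)) {δ : YoungDiagram}
    (hδ : IsCore (k + 1) δ) : IsCore (k + 1) (addCorners k i δ) := by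
  have : Fact (1 < k + 1) := ⟨by omega⟩
  rw [isCore_iff (by omega)] at hδ ⊢
  have hper : ∀ z : ℤ, ((z - (k + 1 : ℕ) : ℤ) : ZMod (k + 1)) = z := by
    intro z
    rw [Int.cast_sub, Int.cast_natCast, ZMod.natCast_self, sub_zero]
  rintro z ⟨r, rfl⟩
  obtain ⟨s, hs⟩ := hδ _ (isBead_bead δ r)
  rcases bead_addCorners k i δ r with ⟨h1, h2⟩ | ⟨h1, h2, h3⟩
  · rcases bead_addCorners k i δ s with ⟨h4, -⟩ | ⟨h4, h5, h6⟩
    · exact ⟨s, by rw [h4, hs, h1]⟩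
    · refine absurd ⟨fun h7 => h5 ?_, ?_⟩ h2
      · have := hδ _ h7
        rwa [hs, sub_add_eq_add_sub]
      · rwa [hs, sub_add_eq_add_sub, hper] at h6
  · rw [h1]
    rcases bead_addCorners k i δ s with ⟨h4, h5⟩ | ⟨h4, h5, h6⟩
    · rw [hs, sub_add_eq_add_sub, hper] at h5
      have h6 : IsBead δ (bead δ r + 1 - (k + 1 : ℕ)) := by
        by_contra hn
        exact h5 ⟨hn, h3⟩
      obtain ⟨t, ht⟩ := h6
      rcases bead_addCorners k i δ t with ⟨h7, -⟩ | ⟨-, -, h7⟩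
      · exact ⟨t, h7.trans ht⟩
      · rw [ht, Int.cast_add, hper, h3] at h7
        simp at h7
    · exact ⟨s, by rw [h4, hs, sub_add_eq_add_sub]⟩

/-- The number of cells in the first `x` rows. -/
def rowSum (lam : YoungDiagram) (x : ℕ) : ℕ := ∑ i ∈ Finset.range x, lam.rowLen i

theorem rowSum_succ (lam : YoungDiagram) (x : ℕ) :
    rowSum lam (x + 1) = rowSum lam x + lam.rowLen x := Finset.sum_range_succ _ _

theorem rowSum_mono (lam : YoungDiagram) : Monotone (rowSum lam) :=
  monotone_nat_of_le_succ fun x => by rw [rowSum_succ]; omega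

theorem rowSum_colLen (lam : YoungDiagram) : rowSum lam (lam.colLen 0) = lam.card := by
  unfold rowSum YoungDiagram.card
  rw [Finset.card_eq_sum_card_fiberwise (f := Prod.fst) (t := Finset.range (lam.colLen 0))]
  · refine Finset.sum_congr rfl fun i _ => ?_
    rw [YoungDiagram.rowLen_eq_card]
    congr 1
  · rintro ⟨r, c⟩ h
    simp only [Finset.coe_range, Set.mem_Iio]
    rw [← YoungDiagram.mem_iff_lt_colLen]
    exact lam.up_left_mem le_rfl (Nat.zero_le c) h

theorem rowSum_of_colLen_le (lam : YoungDiagram) {x : ℕ} (h : lam.colLen 0 ≤ x) :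
    rowSum lam x = lam.card := by
  rw [← rowSum_colLen]
  unfold rowSum
  symm
  refine Finset.sum_subset (Finset.range_mono h) fun i _ hi => ?_
  exact rowLen_eq_zero (by simpa using hi)

theorem rowSum_le_card (lam : YoungDiagram) (x : ℕ) : rowSum lam x ≤ lam.card := by
  rw [← rowSum_of_colLen_le lam (le_max_left (lam.colLen 0) x)]
  exact rowSum_mono lam (le_max_right _ _)

theorem sum_take_rowLens (lam : YoungDiagram) (x : ℕ) :
    (lam.rowLens.take x).sum = rowSum lam x := by
  have h : (lam.rowLens.take x).sum = rowSum lam (min x (lam.colLen 0)) := by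
    rw [YoungDiagram.rowLens, ← List.map_take, List.take_range, rowSum, Finset.sum_range,
      ← List.sum_ofFn, List.ofFn_eq_map, ← List.map_coe_finRange_eq_range, List.map_map]
    rfl
  rw [h]
  rcases le_total x (lam.colLen 0) with hx | hx
  · rw [min_eq_left hx]
  · rw [min_eq_right hx, rowSum_colLen, rowSum_of_colLen_le lam hx]

theorem sum_rowLens (lam : YoungDiagram) : lam.rowLens.sum = lam.card := by
  rw [← rowSum_colLen, ← sum_take_rowLens, ← YoungDiagram.length_rowLens, List.take_length]

theorem mem_alphaBlock {lam : YoungDiagram} {x y : ℕ} :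
    y ∈ alphaBlock lam.rowLens x ↔ rowSum lam (x - 1) < y ∧ y ≤ rowSum lam x := by
  rw [alphaBlock, Finset.mem_Ioc, sum_take_rowLens, sum_take_rowLens]

/-- The index of the row of `lam` holding the `y`-th cell in row reading order. -/
noncomputable def rowIndex (lam : YoungDiagram) (y : ℕ) : ℕ :=
  if h : ∃ x, y < rowSum lam (x + 1) then Nat.find h else 0

theorem rowIndex_spec {lam : YoungDiagram} {y : ℕ} (hy : y < lam.card) :
    rowSum lam (rowIndex lam y) ≤ y ∧ y < rowSum lam (rowIndex lam y + 1) := by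
  have h : ∃ x, y < rowSum lam (x + 1) :=
    ⟨lam.colLen 0, by rwa [rowSum_of_colLen_le lam (by omega)]⟩
  rw [rowIndex, dif_pos h]
  refine ⟨?_, Nat.find_spec h⟩
  rcases Nat.eq_zero_or_pos (Nat.find h) with h0 | h0
  · rw [h0]
    simp [rowSum]
  · have := Nat.find_min h (m := Nat.find h - 1) (by omega)
    rw [Nat.sub_add_cancel h0] at this
    omega

theorem rowIndex_eq {lam : YoungDiagram} {x y : ℕ} (h1 : rowSum lam x ≤ y)
    (h2 : y < rowSum lam (x + 1)) : rowIndex lam y = x := by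
  obtain ⟨h3, h4⟩ := rowIndex_spec (h2.trans_le (rowSum_le_card lam _))
  rcases lt_trichotomy (rowIndex lam y) x with h | h | h
  · have := rowSum_mono lam (show rowIndex lam y + 1 ≤ x from h)
    omega
  · exact h
  · have := rowSum_mono lam (show x + 1 ≤ rowIndex lam y from h)
    omega

/-- The content of the `y`-th cell of `lam` in row reading order. -/
noncomputable def contentAt (lam : YoungDiagram) (y : ℕ) : ℤ :=
  (y : ℤ) - rowSum lam (rowIndex lam y) - rowIndex lam y

/-- The chain of cores obtained by adding corners whose residues are those of the cells of `lam`
in row reading order. -/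
noncomputable def coreChain (k : ℕ) (lam : YoungDiagram) : ℕ → YoungDiagram
  | 0 => ⊥
  | y + 1 => addCorners k (contentAt lam y : ZMod (k + 1)) (coreChain k lam y)

theorem isStep_coreChain (k : ℕ) (lam : YoungDiagram) (y : ℕ) :
    IsStep k (contentAt lam y : ZMod (k + 1)) (coreChain k lam y) (coreChain k lam (y + 1)) :=
  isStep_addCorners _ _ _

theorem isCore_coreChain {k : ℕ} (hk : 1 ≤ k) (lam : YoungDiagram) (y : ℕ) :
    IsCore (k + 1) (coreChain k lam y) := by
  induction y with
  | zero => exact isCore_bot _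
  | succ y ih => exact isCore_addCorners hk _ ih

theorem coreChain_mono (k : ℕ) (lam : YoungDiagram) : Monotone (coreChain k lam) :=
  monotone_nat_of_le_succ fun y => (isStep_coreChain k lam y).1

theorem rowLen_bot (r : ℕ) : (⊥ : YoungDiagram).rowLen r = 0 := by
  by_contra h
  exact YoungDiagram.notMem_bot (r, 0) (YoungDiagram.mem_iff_lt_rowLen.2 (by omega))

theorem addable_of_inv {k : ℕ} {lam δ : YoungDiagram} {x y : ℕ}
    (h1 : rowSum lam x ≤ y) (h2 : y < rowSum lam (x + 1))
    (hp : ∀ r, pRow k δ r = min (lam.rowLen r) (y - rowSum lam r))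
    (hl : ∀ r, y ≤ rowSum lam (r + 1) → δ.rowLen r = y - rowSum lam r) :
    Addable δ (x, y - rowSum lam x) := by
  have hx := hl x h2.le
  refine addable_iff.2 ⟨hx, ?_⟩
  rintro ⟨s, hs⟩
  have hsx : s < x := (bead_strictAnti δ).lt_iff_gt.1 (by omega)
  have h3 := δ.rowLen_anti s (x - 1) (by omega)
  have h4 := pRow_le_rowLen k δ (x - 1)
  rw [hp] at h4
  have h5 := rowSum_succ lam (x - 1)
  rw [show x - 1 + 1 = x by omega] at h5
  have h6 := rowSum_succ lam x
  have h7 := lam.rowLen_anti (x - 1) x (by omega)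
  simp only [bead] at hs
  omega

theorem coreChain_inv {k : ℕ} (hk : 1 ≤ k) {lam : YoungDiagram} (hlam : IsKBounded k lam) {y : ℕ}
    (hy : y ≤ lam.card) :
    (∀ r, pRow k (coreChain k lam y) r = min (lam.rowLen r) (y - rowSum lam r)) ∧
    ∀ r, y ≤ rowSum lam (r + 1) → (coreChain k lam y).rowLen r = y - rowSum lam r := by
  induction y with
  | zero =>
    refine ⟨fun r => ?_, fun r _ => ?_⟩
    · have := pRow_le_rowLen k ⊥ r
      rw [rowLen_bot] at this
      simp only [coreChain]
      omega
    · simp [coreChain, rowLen_bot]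
  | succ y ih =>
    obtain ⟨hp, hl⟩ := ih (by omega)
    obtain ⟨h1, h2⟩ := rowIndex_spec (lam := lam) (y := y) (by omega)
    have hadd := addable_of_inv h1 h2 hp hl
    have hst := isStep_coreChain k lam y
    have hc := isCore_coreChain hk lam y
    have hc' := isCore_coreChain hk lam (y + 1)
    have hcont : contentAt lam y = (y : ℤ) - rowSum lam (rowIndex lam y) - rowIndex lam y := rfl
    have hx := hl _ h2.le
    have hbead := bead_addCorners k (contentAt lam y : ZMod (k + 1)) (coreChain k lam y)
    change ∀ r, (bead (coreChain k lam (y + 1)) r = _ ∧ _) ∨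
      (bead (coreChain k lam (y + 1)) r = _ ∧ _) at hbead
    generalize rowIndex lam y = x at *
    have hcx : bead (coreChain k lam y) x + 1 = contentAt lam y := by
      simp only [bead]
      omega
    have hR : bead (coreChain k lam (y + 1)) x = bead (coreChain k lam y) x + 1 := by
      rcases hbead x with ⟨-, h⟩ | ⟨h, -⟩
      · exact absurd ⟨(addable_iff.1 hadd).2, by rw [hcx]⟩ h
      · exact h
    have hsum : ∀ r, x < r → y < rowSum lam r := fun r hr =>
      h2.trans_le (rowSum_mono lam hr)
    have hzero : ∀ r, x < r → (coreChain k lam y).rowLen r = 0 := fun r hr => by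
      have := hsum r hr
      have := rowSum_mono lam (show r ≤ r + 1 by omega)
      rw [hl r (by omega)]
      omega
    have htop : ∀ r, x < r →
        bead (coreChain k lam (y + 1)) r = bead (coreChain k lam y) r := by
      intro r hr
      rcases hbead r with ⟨h, -⟩ | ⟨-, h3, h4⟩
      · exact h
      · exfalso
        have hr1 : r = x + 1 := by
          by_contra hne
          apply h3
          refine ⟨r - 1, ?_⟩
          simp only [bead]
          rw [hzero r hr, hzero (r - 1) (by omega)]
          omega
        subst hr1
        have hlx := hlam x
        have h5 := rowSum_succ lam x
        refine intCast_ne_of_lt (k := k) ?_ ?_ h4 <;> simp only [bead] <;> rw [hzero _ hr] <;> omega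
    have hP := hst.pRow_eq hk hc hc' hR htop
    refine ⟨fun r => ?_, fun r hr => ?_⟩
    · rw [hP, hp]
      have h5 := rowSum_succ lam r
      split_ifs with hrx
      · subst hrx
        omega
      · rcases Nat.lt_or_gt_of_ne hrx with h | h
        · have := rowSum_mono lam (show r + 1 ≤ x from h)
          omega
        · have := hsum r h
          omega
    · have h5 := rowSum_succ lam r
      rcases lt_trichotomy r x with h | rfl | h
      · have := rowSum_mono lam (show r + 1 ≤ x from h)
        omega
      · simp only [bead] at hR
        omega
      · have h6 := htop r h
        have := hzero r h
        have := hsum r h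
        simp only [bead] at h6
        omega

theorem addable_coreChain {k : ℕ} (hk : 1 ≤ k) {lam : YoungDiagram} (hlam : IsKBounded k lam)
    {y : ℕ} (hy : y < lam.card) :
    Addable (coreChain k lam y) (rowIndex lam y, y - rowSum lam (rowIndex lam y)) ∧
      residue k (rowIndex lam y, y - rowSum lam (rowIndex lam y)) = contentAt lam y := by
  obtain ⟨hp, hl⟩ := coreChain_inv hk hlam hy.le
  obtain ⟨h1, h2⟩ := rowIndex_spec hy
  refine ⟨addable_of_inv h1 h2 hp hl, ?_⟩
  rw [residue_eq, contentAt]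
  push_cast [h1]
  ring

theorem pRow_coreChain_card {k : ℕ} (hk : 1 ≤ k) {lam : YoungDiagram} (hlam : IsKBounded k lam)
    (r : ℕ) : pRow k (coreChain k lam lam.card) r = lam.rowLen r := by
  rw [(coreChain_inv hk hlam le_rfl).1]
  have := rowSum_succ lam r
  have := rowSum_le_card lam (r + 1)
  omega

theorem coreOf_spec {k : ℕ} (hk : 1 ≤ k) {lam : YoungDiagram} (hlam : IsKBounded k lam) :
    IsCore (k + 1) (coreOf k lam) ∧ ∀ i, pRow k (coreOf k lam) i = lam.rowLen i :=
  Classical.epsilon_spec (p := fun γ => IsCore (k + 1) γ ∧ ∀ i, pRow k γ i = lam.rowLen i)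
    ⟨coreChain k lam lam.card, isCore_coreChain hk lam _, pRow_coreChain_card hk hlam⟩

theorem coreChain_card {k : ℕ} (hk : 1 ≤ k) {lam : YoungDiagram} (hlam : IsKBounded k lam) :
    coreChain k lam lam.card = coreOf k lam :=
  eq_of_pRow_eq (isCore_coreChain hk lam _) (coreOf_spec hk hlam).1 fun r => by
    rw [pRow_coreChain_card hk hlam, (coreOf_spec hk hlam).2]

theorem IsStdASVT.exists_chain {k n : ℕ} {γ : YoungDiagram} {e : ℕ × ℕ → Finset ℕ} (hk : 1 ≤ k)
    (h : IsStdASVT k n γ e) :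
    ∃ (D : ℕ → YoungDiagram) (i : ℕ → ZMod (k + 1)) (T : ℕ → Option ℕ),
      D n = γ ∧ (∀ y ≤ n, IsCore (k + 1) (D y)) ∧
      (∀ x, 1 ≤ x → x ≤ n → ∀ c, x ∈ e c ↔ Removable (D x) c ∧ residue k c = i x) ∧
      (∀ y ≤ n, ∀ r, pRow k (D y) r = ((Finset.range y).filter fun z => T z = some r).card) ∧
      (∀ z < n, ∀ R, T z = some R →
        ∃ c, (R, c) ∈ D (z + 1) ∧ (R, c) ∉ D z ∧ z + 1 ∈ e (R, c)) ∧
      ∀ z < n, ∀ c, c ∈ D (z + 1) → c ∉ D z → z + 1 ∈ e c := by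
  obtain ⟨⟨hne, hpos, -, -⟩, hle, hch⟩ := h
  have hex : ∀ x, ∃ (δ : YoungDiagram) (j : ZMod (k + 1)), x ≤ n → (IsCore (k + 1) δ ∧
      (∀ c, c ∈ δ ↔ ∃ y ∈ e c, y ≤ x) ∧
      (1 ≤ x → ∀ c, x ∈ e c ↔ Removable δ c ∧ residue k c = j)) := by
    intro x
    rcases Nat.eq_zero_or_pos x with rfl | hx
    · refine ⟨⊥, 0, fun _ => ⟨isCore_bot _, fun c => ?_, fun h => by omega⟩⟩
      refine iff_of_false (YoungDiagram.notMem_bot c) ?_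
      rintro ⟨y, hy, hy0⟩
      have := hpos c y hy
      omega
    · by_cases hxn : x ≤ n
      · obtain ⟨δ, h1, h2, j, -, h3⟩ := hch x hx hxn
        refine ⟨δ, j, fun _ => ⟨h1, fun c => ?_, fun _ => h3⟩⟩
        rw [← YoungDiagram.mem_cells, h2, shapeLe, Finset.mem_filter, YoungDiagram.mem_cells]
        refine and_iff_right_of_imp ?_
        rintro ⟨y, hy, -⟩
        exact (hne c).2 ⟨y, hy⟩
      · exact ⟨⊥, 0, fun h => absurd h hxn⟩
  choose D i hD using hex
  have hnew : ∀ z < n, ∀ c, c ∈ D (z + 1) → c ∉ D z → z + 1 ∈ e c := by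
    intro z hz c hc hcn
    obtain ⟨y, hy, hyz⟩ := ((hD (z + 1) hz).2.1 c).1 hc
    rw [(hD z hz.le).2.1 c] at hcn
    have : y = z + 1 := by
      by_contra hne
      exact hcn ⟨y, hy, by omega⟩
    rwa [← this]
  have hstep : ∀ z < n, IsStep k (i (z + 1)) (D z) (D (z + 1)) := by
    intro z hz
    refine ⟨fun c hc => ?_, fun c hc hcn => ?_⟩
    · obtain ⟨y, hy, hyz⟩ := ((hD z hz.le).2.1 c).1 hc
      exact ((hD (z + 1) hz).2.1 c).2 ⟨y, hy, by omega⟩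
    · exact ((hD (z + 1) hz).2.2 (by omega) c).1 (hnew z hz c hc hcn)
  have hT : ∀ z, ∃ T : Option ℕ, z < n →
      (∀ r, pRow k (D (z + 1)) r = pRow k (D z) r + if T = some r then 1 else 0) ∧
      ∀ R, T = some R → ∃ c, (R, c) ∈ D (z + 1) ∧ (R, c) ∉ D z := by
    intro z
    by_cases hz : z < n
    · obtain ⟨T, hT⟩ := (hstep z hz).exists_top hk (hD z hz.le).1 (hD (z + 1) hz).1
      exact ⟨T, fun _ => hT⟩
    · exact ⟨none, fun h => absurd h hz⟩
  choose T hT using hT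
  refine ⟨D, i, T, ?_, fun y hy => (hD y hy).1, fun x h1 h2 => (hD x h2).2.2 h1, ?_, ?_, hnew⟩
  · ext c
    rw [YoungDiagram.mem_cells, YoungDiagram.mem_cells, (hD n le_rfl).2.1, hne]
    exact ⟨fun ⟨y, hy, _⟩ => ⟨y, hy⟩, fun ⟨y, hy⟩ => ⟨y, hy, hle c y hy⟩⟩
  · intro y hy r
    induction y with
    | zero =>
      have : D 0 = ⊥ := by
        ext c
        rw [YoungDiagram.mem_cells, (hD 0 hy).2.1]
        refine iff_of_false ?_ (YoungDiagram.notMem_bot c)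
        rintro ⟨y, hy, hy0⟩
        have := hpos c y hy
        omega
      rw [this]
      have := pRow_le_rowLen k ⊥ r
      rw [rowLen_bot] at this
      simpa using this
    | succ y ih =>
      rw [(hT y (by omega)).1, ih (by omega), Finset.range_add_one, Finset.filter_insert]
      split_ifs with hy
      · rw [Finset.card_insert_of_notMem (by simp)]
      · rfl
  · intro z hz R hR
    obtain ⟨c, h1, h2⟩ := (hT z hz).2 R hR
    exact ⟨c, h1, h2, hnew z hz _ h1 h2⟩

theorem card_filter_lt (s : Finset ℕ) (T : ℕ → Option ℕ) (x : ℕ) :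
    (s.filter fun z => ∃ r < x, T z = some r).card =
      ∑ r ∈ Finset.range x, (s.filter fun z => T z = some r).card := by
  induction x with
  | zero => simp
  | succ x ih =>
    rw [Finset.sum_range_succ, ← ih, ← Finset.card_union_of_disjoint]
    · congr 1
      ext z
      simp only [Finset.mem_filter, Finset.mem_union, Nat.lt_succ_iff_lt_or_eq]
      grind
    · rw [Finset.disjoint_left]
      simp only [Finset.mem_filter]
      rintro z ⟨-, r, hr, h1⟩ ⟨-, h2⟩
      rw [h1, Option.some.injEq] at h2
      omega

/-- Letters of the first `x` blocks lie in the first `x` rows. -/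
theorem IsASVT.row_lt {k : ℕ} {mu γ : YoungDiagram} {e : ℕ × ℕ → Finset ℕ}
    (h : IsASVT k mu.rowLens γ e) {r c x y : ℕ} (hy : y ∈ e (r, c)) (hyx : y ≤ rowSum mu x) :
    r < x := by
  obtain ⟨⟨⟨hne, hpos, hcol, -⟩, hle, -⟩, hblk⟩ := h
  induction r generalizing x y with
  | zero =>
    have := hpos _ _ hy
    rcases Nat.eq_zero_or_pos x with rfl | hx
    · simp [rowSum] at hyx
      omega
    · exact hx
  | succ r ih =>
    have hmem : (r, c) ∈ γ := γ.up_left_mem (Nat.le_succ r) le_rfl ((hne _).2 ⟨y, hy⟩)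
    obtain ⟨w, hw⟩ := (hne _).1 hmem
    have hwy := hcol r c w hw y hy
    have hw0 := hpos _ _ hw
    have hyn := hle _ _ hy
    rw [sum_rowLens] at hyn
    obtain ⟨h1, h2⟩ := rowIndex_spec (lam := mu) (y := y - 1) (by omega)
    set x' := rowIndex mu (y - 1)
    have hx' : x' < x := by
      by_contra hn
      have := rowSum_mono mu (show x ≤ x' by omega)
      omega
    suffices r < x' by omega
    refine ih hw ?_
    by_contra hn
    have hlen : x' + 1 ≤ mu.rowLens.length := by
      rw [YoungDiagram.length_rowLens]
      by_contra hc
      have := rowLen_eq_zero (γ := mu) (r := x') (by omega)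
      have := rowSum_succ mu x'
      omega
    have hstrip := (hblk (x' + 1) (by omega) hlen).2.2 (r, c) (r + 1, c)
      ⟨w, mem_alphaBlock.2 ⟨by simp; omega, by omega⟩, hw⟩
      ⟨y, mem_alphaBlock.2 ⟨by simp; omega, by omega⟩, hy⟩ rfl
    simp at hstrip

theorem IsASVT.card_le_and_dominates {k : ℕ} {lam mu γ : YoungDiagram} {e : ℕ × ℕ → Finset ℕ}
    (hk : 1 ≤ k) (h : IsASVT k mu.rowLens γ e) (hγ : ∀ r, pRow k γ r = lam.rowLen r) :
    lam.card ≤ mu.card ∧ (mu.card = lam.card → Dominates lam mu) := by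
  obtain ⟨D, i, T, hn, -, -, hp, hT, -⟩ := h.1.exists_chain hk
  rw [sum_rowLens] at hn hp hT
  have hsum : ∀ x, ((Finset.range mu.card).filter fun z => ∃ r < x, T z = some r).card =
      rowSum lam x := by
    intro x
    rw [card_filter_lt, rowSum]
    exact Finset.sum_congr rfl fun r _ => by rw [← hp _ le_rfl, hn, hγ]
  have hN := hsum (lam.colLen 0)
  rw [rowSum_colLen] at hN
  refine ⟨?_, fun hcard => ⟨hcard.symm, fun x => ?_⟩⟩
  · rw [← hN]
    exact (Finset.card_filter_le _ _).trans (by simp)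
  · change rowSum mu x ≤ rowSum lam x
    rw [← hsum x]
    have hall : ((Finset.range mu.card).filter fun z => ∃ r < lam.colLen 0, T z = some r) =
        Finset.range mu.card :=
      Finset.eq_of_subset_of_card_le (Finset.filter_subset _ _) (by rw [hN, ← hcard]; simp)
    conv_lhs => rw [← Finset.card_range (rowSum mu x)]
    refine Finset.card_le_card fun z hz => ?_
    rw [Finset.mem_range] at hz
    have hz' : z < mu.card := hz.trans_le (rowSum_le_card mu x)
    have hz2 : z ∈ Finset.range mu.card := Finset.mem_range.2 hz'
    rw [← hall, Finset.mem_filter] at hz2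
    obtain ⟨-, R, -, hR⟩ := hz2
    obtain ⟨c, -, -, hc⟩ := hT z hz' R hR
    exact Finset.mem_filter.2 ⟨Finset.mem_range.2 hz', R, h.row_lt hc hz, hR⟩

theorem IsASVT.unique {k : ℕ} {lam γ : YoungDiagram} {e e' : ℕ × ℕ → Finset ℕ} (hk : 1 ≤ k)
    (hγ : ∀ r, pRow k γ r = lam.rowLen r) (h : IsASVT k lam.rowLens γ e)
    (h' : IsASVT k lam.rowLens γ e') : e = e' := by
  have key : ∀ e, IsASVT k lam.rowLens γ e →
      ∃ (D : ℕ → YoungDiagram) (i : ℕ → ZMod (k + 1)),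
      (∀ y ≤ lam.card, IsCore (k + 1) (D y)) ∧
      (∀ x, 1 ≤ x → x ≤ lam.card →
        ∀ c, x ∈ e c ↔ Removable (D x) c ∧ residue k c = i x) ∧
      (∀ y ≤ lam.card, ∀ r,
        pRow k (D y) r = ((Finset.range y).filter fun z => rowIndex lam z = r).card) ∧
      (∀ z < lam.card, ∃ c, c ∈ D (z + 1) ∧ c ∉ D z) ∧
      ∀ z < lam.card, ∀ c, c ∈ D (z + 1) → c ∉ D z → z + 1 ∈ e c := by
    intro e h
    obtain ⟨D, i, T, hn, hcore, hmem, hp, hT, hnew⟩ := h.1.exists_chain hk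
    rw [sum_rowLens] at hn hp hT hnew hmem hcore
    have hsum : ∀ x, ((Finset.range lam.card).filter fun z => ∃ r < x, T z = some r).card =
        rowSum lam x := by
      intro x
      rw [card_filter_lt, rowSum]
      exact Finset.sum_congr rfl fun r _ => by rw [← hp _ le_rfl, hn, hγ]
    have hN := hsum (lam.colLen 0)
    rw [rowSum_colLen] at hN
    have hall : ((Finset.range lam.card).filter fun z => ∃ r < lam.colLen 0, T z = some r) =
        Finset.range lam.card :=
      Finset.eq_of_subset_of_card_le (Finset.filter_subset _ _) (by rw [hN]; simp)
    have hsome : ∀ z < lam.card, ∃ R, T z = some R := by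
      intro z hz
      have hz2 : z ∈ Finset.range lam.card := Finset.mem_range.2 hz
      rw [← hall, Finset.mem_filter] at hz2
      obtain ⟨-, R, -, hR⟩ := hz2
      exact ⟨R, hR⟩
    have hlt : ∀ x, Finset.range (rowSum lam x) =
        (Finset.range lam.card).filter fun z => ∃ r < x, T z = some r := by
      intro x
      refine Finset.eq_of_subset_of_card_le (fun z hz => ?_) (by rw [hsum]; simp)
      rw [Finset.mem_range] at hz
      have hz' : z < lam.card := hz.trans_le (rowSum_le_card lam x)
      obtain ⟨R, hR⟩ := hsome z hz'
      obtain ⟨c, -, -, hc⟩ := hT z hz' R hR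
      exact Finset.mem_filter.2 ⟨Finset.mem_range.2 hz', R, h.row_lt hc hz, hR⟩
    have hTz : ∀ z < lam.card, T z = some (rowIndex lam z) := by
      intro z hz
      obtain ⟨R, hR⟩ := hsome z hz
      rw [hR, Option.some.injEq]
      symm
      apply rowIndex_eq
      · by_contra hn
        have h1 : z ∈ Finset.range (rowSum lam R) := Finset.mem_range.2 (by omega)
        rw [hlt, Finset.mem_filter] at h1
        obtain ⟨-, r, hr, hr'⟩ := h1
        rw [hR, Option.some.injEq] at hr'
        omega
      · rw [← Finset.mem_range, hlt, Finset.mem_filter]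
        exact ⟨Finset.mem_range.2 hz, R, by omega, hR⟩
    refine ⟨D, i, hcore, hmem, fun y hy r => ?_, fun z hz => ?_, hnew⟩
    · rw [hp y hy]
      congr 1
      refine Finset.filter_congr fun z hz => ?_
      rw [Finset.mem_range] at hz
      rw [hTz z (by omega), Option.some.injEq]
    · obtain ⟨c, h1, h2, -⟩ := hT z hz _ (hTz z hz)
      exact ⟨_, h1, h2⟩
  obtain ⟨D, i, hcore, hmem, hp, hex, hnew⟩ := key e h
  obtain ⟨D', i', hcore', hmem', hp', -, hnew'⟩ := key e' h'
  have hD : ∀ y ≤ lam.card, D y = D' y := fun y hy =>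
    eq_of_pRow_eq (hcore y hy) (hcore' y hy) fun r => by rw [hp y hy, hp' y hy]
  have heq : ∀ y, 1 ≤ y → y ≤ lam.card → ∀ c, y ∈ e c ↔ y ∈ e' c := by
    intro y h1 h2 c
    obtain ⟨z, rfl⟩ : ∃ z, y = z + 1 := ⟨y - 1, by omega⟩
    obtain ⟨d, hd1, hd2⟩ := hex z h2
    have h3 := hnew z h2 d hd1 hd2
    rw [hD _ h2] at hd1
    rw [hD _ (by omega)] at hd2
    have h4 := hnew' z h2 d hd1 hd2
    have hi : i (z + 1) = i' (z + 1) := by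
      rw [← ((hmem _ h1 h2 d).1 h3).2, ((hmem' _ h1 h2 d).1 h4).2]
    rw [hmem _ h1 h2, hmem' _ h1 h2, hD _ h2, hi]
  have hle : ∀ e, IsASVT k lam.rowLens γ e → ∀ c, ∀ y ∈ e c, 1 ≤ y ∧ y ≤ lam.card := by
    intro e h c y hy
    refine ⟨h.1.1.2.1 c y hy, ?_⟩
    rw [← sum_rowLens]
    exact h.1.2.1 c y hy
  funext c
  ext y
  exact ⟨fun hy => (heq y (hle e h c y hy).1 (hle e h c y hy).2 c).1 hy,
    fun hy => (heq y (hle e' h' c y hy).1 (hle e' h' c y hy).2 c).2 hy⟩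

section ChainTableau

/-- The filling recording the steps of `coreChain`. -/
noncomputable def chainTableau (k : ℕ) (lam : YoungDiagram) (c : ℕ × ℕ) : Finset ℕ :=
  (Finset.Icc 1 lam.card).filter fun y => c ∈ coreChain k lam y ∧ c ∉ coreChain k lam (y - 1)

variable {k : ℕ} {lam : YoungDiagram}

theorem mem_chainTableau {c : ℕ × ℕ} {y : ℕ} :
    y + 1 ∈ chainTableau k lam c ↔
      y < lam.card ∧ c ∈ coreChain k lam (y + 1) ∧ c ∉ coreChain k lam y := by
  rw [chainTableau, Finset.mem_filter, Finset.mem_Icc, Nat.add_sub_cancel]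
  exact and_congr_left' ⟨fun h => h.2, fun h => ⟨Nat.succ_pos y, h⟩⟩

theorem mem_chainTableau_cases {c : ℕ × ℕ} {x : ℕ} (h : x ∈ chainTableau k lam c) :
    ∃ y, x = y + 1 ∧ y < lam.card ∧ c ∈ coreChain k lam (y + 1) ∧ c ∉ coreChain k lam y := by
  simp only [chainTableau, Finset.mem_filter, Finset.mem_Icc] at h
  refine ⟨x - 1, by omega, by omega, ?_, h.2.2⟩
  rw [Nat.sub_add_cancel h.1.1]
  exact h.2.1

theorem mem_coreChain_iff {c : ℕ × ℕ} {x : ℕ} (hx : x ≤ lam.card) :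
    c ∈ coreChain k lam x ↔ ∃ y ∈ chainTableau k lam c, y ≤ x := by
  constructor
  · intro h
    induction x with
    | zero => exact absurd h (YoungDiagram.notMem_bot c)
    | succ x ih =>
      by_cases hc : c ∈ coreChain k lam x
      · obtain ⟨y, hy, hyx⟩ := ih (by omega) hc
        exact ⟨y, hy, by omega⟩
      · exact ⟨x + 1, mem_chainTableau.2 ⟨hx, h, hc⟩, le_rfl⟩
  · rintro ⟨y, hy, hyx⟩
    obtain ⟨y, rfl, -, h, -⟩ := mem_chainTableau_cases hy
    exact coreChain_mono k lam hyx h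

theorem residue_of_mem_chainTableau {c : ℕ × ℕ} {y : ℕ} (h : y + 1 ∈ chainTableau k lam c) :
    residue k c = contentAt lam y :=
  have h := mem_chainTableau.1 h
  ((isStep_coreChain k lam y).2 c h.2.1 h.2.2).2

theorem removable_of_mem_chainTableau {c : ℕ × ℕ} {y : ℕ} (h : y + 1 ∈ chainTableau k lam c) :
    Removable (coreChain k lam (y + 1)) c :=
  have h := mem_chainTableau.1 h
  ((isStep_coreChain k lam y).2 c h.2.1 h.2.2).1

theorem addable_mem_chainTableau {c : ℕ × ℕ} {y : ℕ} (hy : y < lam.card)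
    (h : Addable (coreChain k lam y) c) (hr : residue k c = contentAt lam y) :
    y + 1 ∈ chainTableau k lam c :=
  mem_chainTableau.2 ⟨hy, mem_addCorners.2 (Or.inr ⟨h, hr⟩), h.1⟩

theorem isSVFilling_chainTableau (hk : 1 ≤ k) (hlam : IsKBounded k lam) :
    IsSVFilling (coreOf k lam) (chainTableau k lam) := by
  refine ⟨fun c => ?_, fun c x hx => ?_, fun r c x hx y hy => ?_, fun r c x hx y hy => ?_⟩
  · rw [← coreChain_card hk hlam, mem_coreChain_iff le_rfl]
    refine ⟨fun ⟨y, hy, _⟩ => ⟨y, hy⟩, fun ⟨y, hy⟩ => ⟨y, hy, ?_⟩⟩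
    obtain ⟨z, rfl, hz, -⟩ := mem_chainTableau_cases hy
    exact hz
  · obtain ⟨z, rfl, -⟩ := mem_chainTableau_cases hx
    omega
  · have hrem := removable_of_mem_chainTableau (y := x - 1) (k := k) (lam := lam) (c := (r, c))
    obtain ⟨x, rfl, -, -, hx2⟩ := mem_chainTableau_cases hx
    obtain ⟨y, rfl, -, hy1, -⟩ := mem_chainTableau_cases hy
    by_contra hn
    exact (hrem hx).2.1 (coreChain_mono k lam (show y + 1 ≤ x + 1 by omega) hy1)
  · obtain ⟨x, rfl, -, -, hx2⟩ := mem_chainTableau_cases hx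
    obtain ⟨y, rfl, -, hy1, -⟩ := mem_chainTableau_cases hy
    by_contra hn
    exact hx2 (coreChain_mono k lam (show y + 1 ≤ x by omega)
      ((coreChain k lam (y + 1)).up_left_mem le_rfl (Nat.le_succ c) hy1))

theorem isStdASVT_chainTableau (hk : 1 ≤ k) (hlam : IsKBounded k lam) :
    IsStdASVT k lam.card (coreOf k lam) (chainTableau k lam) := by
  refine ⟨isSVFilling_chainTableau hk hlam, fun c y hy => ?_, fun x hx1 hx => ?_⟩
  · obtain ⟨z, rfl, hz, -⟩ := mem_chainTableau_cases hy
    exact hz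
  obtain ⟨x, rfl⟩ : ∃ z, x = z + 1 := ⟨x - 1, by omega⟩
  obtain ⟨hadd, hres⟩ := addable_coreChain hk hlam (y := x) hx
  refine ⟨coreChain k lam (x + 1), isCore_coreChain hk lam _, ?_, contentAt lam x,
    ⟨_, addable_mem_chainTableau hx hadd hres⟩, fun c =>
      ⟨fun h => ⟨removable_of_mem_chainTableau h, residue_of_mem_chainTableau h⟩, ?_⟩⟩
  · ext c
    rw [YoungDiagram.mem_cells, mem_coreChain_iff hx, shapeLe, Finset.mem_filter,
      YoungDiagram.mem_cells]
    refine (and_iff_right_of_imp ?_).symm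
    rintro ⟨y, hy, -⟩
    exact ((isSVFilling_chainTableau hk hlam).1 c).2 ⟨y, hy⟩
  · rintro ⟨hrem, hc⟩
    refine mem_chainTableau.2 ⟨hx, hrem.1, fun hmem => ?_⟩
    have hmono := (isStep_coreChain k lam x).1
    obtain ⟨r, c⟩ := c
    have hrem' : Removable (coreChain k lam x) (r, c) :=
      ⟨hmem, fun h => hrem.2.1 (hmono h), fun h => hrem.2.2 (hmono h)⟩
    rw [removable_iff] at hrem'
    rw [addable_iff] at hadd
    refine (isCore_coreChain hk lam x).not_addable_and_removable ?_ (isBead_bead _ r) hrem'.2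
      (isBead_bead _ _) hadd.2
    rw [residue_eq] at hc hres
    have e1 : bead (coreChain k lam x) r = (c : ℤ) - r := by
      simp only [bead, hrem'.1]
      omega
    have e2 : bead (coreChain k lam x) (rowIndex lam x) + 1 =
        ((x - rowSum lam (rowIndex lam x) : ℕ) : ℤ) - (rowIndex lam x : ℤ) := by
      simp only [bead, hadd.1]
      omega
    rw [e1, e2, hc, hres]

theorem contentAt_succ {y : ℕ} (h : rowIndex lam y = rowIndex lam (y + 1)) :
    contentAt lam (y + 1) = contentAt lam y + 1 := by
  simp only [contentAt, h]
  push_cast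
  ring

theorem exists_succ_mem_chainTableau (hk : 1 ≤ k) (hlam : IsKBounded k lam) {r c y : ℕ}
    (hy : y + 1 < lam.card) (hidx : rowIndex lam y = rowIndex lam (y + 1))
    (h : y + 1 ∈ chainTableau k lam (r, c)) :
    ∃ d : ℕ × ℕ, d.1 ≤ r ∧ y + 2 ∈ chainTableau k lam d := by
  obtain ⟨hadd, hres⟩ := addable_coreChain hk hlam hy
  generalize rowIndex lam (y + 1) = s at hadd hres
  generalize y + 1 - rowSum lam s = t at hadd hres
  by_cases hsr : s ≤ r
  · exact ⟨_, hsr, addable_mem_chainTableau hy hadd hres⟩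
  have hrem := removable_iff.1 (removable_of_mem_chainTableau h)
  have hc := residue_of_mem_chainTableau h
  rw [addable_iff] at hadd
  rw [residue_eq] at hc hres
  have hlt := bead_strictAnti (coreChain k lam (y + 1)) (show r < s by omega)
  have e1 : bead (coreChain k lam (y + 1)) r = (c : ℤ) - r := by
    simp only [bead, hrem.1]
    omega
  have e2 : bead (coreChain k lam (y + 1)) s + 1 = (t : ℤ) - s := by
    simp only [bead, hadd.1]
    omega
  refine ⟨(r, c + 1), le_rfl, addable_mem_chainTableau hy (addable_iff.2 ⟨hrem.1, fun hb => ?_⟩) ?_⟩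
  · refine hadd.2 ((isCore_coreChain hk lam (y + 1)).isBead_of_le ?_ (by omega) hb)
    rw [e2, hres, contentAt_succ hidx, e1, Int.cast_add, Int.cast_add, hc]
  · rw [residue_eq, contentAt_succ hidx, Int.cast_add, ← hc]
    push_cast
    ring

theorem exists_mem_chainTableau_of_le (hk : 1 ≤ k) (hlam : IsKBounded k lam) {x r c y z : ℕ}
    (hyz : y ≤ z) (h1 : rowSum lam x ≤ y) (h2 : z < rowSum lam (x + 1))
    (h : y + 1 ∈ chainTableau k lam (r, c)) :
    ∃ d : ℕ × ℕ, d.1 ≤ r ∧ z + 1 ∈ chainTableau k lam d := by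
  induction z, hyz using Nat.le_induction with
  | base => exact ⟨(r, c), le_rfl, h⟩
  | succ z hz ih =>
    obtain ⟨⟨s, d⟩, hd, hm⟩ := ih (by omega)
    obtain ⟨d', hd', hm'⟩ := exists_succ_mem_chainTableau hk hlam
      (h2.trans_le (rowSum_le_card lam _))
      ((rowIndex_eq (x := x) (by omega) (by omega)).trans
        (rowIndex_eq (by omega) (by omega)).symm) hm
    exact ⟨d', hd'.trans hd, hm'⟩

theorem isASVT_chainTableau (hk : 1 ≤ k) (hlam : IsKBounded k lam) :
    IsASVT k lam.rowLens (coreOf k lam) (chainTableau k lam) := by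
  refine ⟨by rw [sum_rowLens]; exact isStdASVT_chainTableau hk hlam, fun x hx1 hx => ?_⟩
  obtain ⟨x, rfl⟩ : ∃ z, x = z + 1 := ⟨x - 1, by omega⟩
  have hsucc := rowSum_succ lam x
  have hlx := hlam x
  have hblock : ∀ y, y ∈ alphaBlock lam.rowLens (x + 1) ↔
      rowSum lam x < y ∧ y ≤ rowSum lam (x + 1) := fun y => by
    rw [mem_alphaBlock, Nat.add_sub_cancel]
  have hcont : ∀ y, rowSum lam x ≤ y → y < rowSum lam (x + 1) →
      contentAt lam y = (y : ℤ) - rowSum lam x - x := fun y h1 h2 => by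
    rw [contentAt, rowIndex_eq h1 h2]
  have hres : ∀ c y, y ∈ alphaBlock lam.rowLens (x + 1) → y ∈ chainTableau k lam c →
      residue k c = (((y : ℤ) - 1 - rowSum lam x - x : ℤ) : ZMod (k + 1)) := by
    intro c y hy hc
    rw [hblock] at hy
    obtain ⟨z, rfl, -⟩ := mem_chainTableau_cases hc
    rw [residue_of_mem_chainTableau hc, hcont z (by omega) (by omega)]
    push_cast
    ring
  refine ⟨?_, ?_, ?_⟩
  · intro y z hy hz hyz cy cz hcy hcz
    rw [hblock] at hy hz
    obtain ⟨y, rfl, -, hy1, -⟩ := mem_chainTableau_cases hcy.1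
    obtain ⟨z, rfl, -, -, hz2⟩ := mem_chainTableau_cases hcz.1
    obtain ⟨d, hd, hdz⟩ := exists_mem_chainTableau_of_le hk hlam (x := x) (y := y) (z := z)
      (by omega) (by omega) (by omega) hcy.1
    have hle : cz.1 ≤ cy.1 := (hcz.2 d hdz).trans hd
    rcases hle.lt_or_eq with hlt | heq
    · exact Or.inl hlt
    · refine Or.inr ⟨heq.symm, ?_⟩
      by_contra hn
      exact hz2 (coreChain_mono k lam (show y + 1 ≤ z by omega)
        (YoungDiagram.up_left_mem _ heq.le (not_lt.1 hn) hy1))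
  · have himg : (((coreOf k lam).cells.filter fun c => ∃ y ∈ alphaBlock lam.rowLens (x + 1),
        y ∈ chainTableau k lam c).image (residue k)) =
        (alphaBlock lam.rowLens (x + 1)).image
          fun y : ℕ => (((y : ℤ) - 1 - rowSum lam x - x : ℤ) : ZMod (k + 1)) := by
      ext i
      simp only [Finset.mem_image, Finset.mem_filter, YoungDiagram.mem_cells]
      constructor
      · rintro ⟨c, ⟨-, y, hy, hc⟩, rfl⟩
        exact ⟨y, hy, (hres c y hy hc).symm⟩
      · rintro ⟨y, hy, rfl⟩
        have hy' := (hblock y).1 hy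
        have hcard : y - 1 < lam.card := by
          have := rowSum_le_card lam (x + 1)
          omega
        obtain ⟨hadd, hr⟩ := addable_coreChain hk hlam hcard
        have hm := addable_mem_chainTableau hcard hadd hr
        rw [show y - 1 + 1 = y by omega] at hm
        exact ⟨_, ⟨((isSVFilling_chainTableau hk hlam).1 _).2 ⟨y, hm⟩, y, hy, hm⟩, hres _ y hy hm⟩
    refine (show _ = ((alphaBlock lam.rowLens (x + 1)).image fun y : ℕ =>
      (((y : ℤ) - 1 - rowSum lam x - x : ℤ) : ZMod (k + 1))).card by
        rw [← himg]; congr!).trans ?_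
    rw [Finset.card_image_of_injOn]
    · rw [alphaBlock, Nat.card_Ioc, sum_take_rowLens, sum_take_rowLens, Nat.add_sub_cancel,
        List.getD_eq_getElem _ _ (by omega), YoungDiagram.get_rowLens]
      omega
    · intro y hy z hz heq
      simp only [Finset.mem_coe, hblock] at hy hz
      by_contra hne
      rcases Nat.lt_or_gt_of_ne hne with hlt | hlt
      · exact intCast_ne_of_lt (k := k) (by omega) (by omega) heq
      · exact intCast_ne_of_lt (k := k) (by omega) (by omega) heq.symm
  · have aux : ∀ r s c, r < s → (∃ y ∈ alphaBlock lam.rowLens (x + 1),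
        y ∈ chainTableau k lam (r, c)) → (∃ y ∈ alphaBlock lam.rowLens (x + 1),
        y ∈ chainTableau k lam (s, c)) → False := by
      rintro r s c hrs ⟨y, hy, hyc⟩ ⟨z, hz, hzc⟩
      have hfill := isSVFilling_chainTableau hk hlam
      have hcol : ∀ t, r < t → t ≤ s → ∀ w ∈ chainTableau k lam (t, c), y < w := by
        intro t ht
        induction t, ht using Nat.le_induction with
        | base => exact fun _ w hw => hfill.2.2.1 r c y hyc w hw
        | succ t ht ih =>
          intro hts w hw
          obtain ⟨v, hv⟩ := (hfill.1 (t, c)).1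
            ((coreOf k lam).up_left_mem (Nat.le_succ t) le_rfl ((hfill.1 _).2 ⟨w, hw⟩))
          exact (ih (by omega) v hv).trans (hfill.2.2.1 t c v hv w hw)
      obtain ⟨w, hw⟩ := (hfill.1 (r + 1, c)).1
        ((coreOf k lam).up_left_mem hrs le_rfl ((hfill.1 _).2 ⟨z, hzc⟩))
      have hyw := hcol (r + 1) (by omega) (by omega) w hw
      have hwz : w ≤ z := by
        obtain ⟨z', rfl, hzn, hz1, -⟩ := mem_chainTableau_cases hzc
        obtain ⟨w', rfl, -, -, hw2⟩ := mem_chainTableau_cases hw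
        by_contra hn
        exact hw2 (coreChain_mono k lam (show z' + 1 ≤ w' by omega)
          (YoungDiagram.up_left_mem _ hrs le_rfl hz1))
      have hy' := (hblock y).1 hy
      have hz' := (hblock z).1 hz
      have h1 := hres _ y hy hyc
      have h2 := hres _ w ((hblock w).2 (by omega)) hw
      rw [residue_eq] at h1 h2
      have h3 : (((y : ℤ) - 1 - rowSum lam x - x : ℤ) : ZMod (k + 1)) =
          (((w : ℤ) - rowSum lam x - x : ℤ) : ZMod (k + 1)) := by
        rw [← h1]
        have h4 : (((c : ℤ) - (r + 1 : ℕ) + 1 : ℤ) : ZMod (k + 1)) =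
            (((w : ℤ) - 1 - rowSum lam x - x + 1 : ℤ) : ZMod (k + 1)) := by
          rw [Int.cast_add, h2, Int.cast_add]
        convert h4 using 2 <;> push_cast <;> ring
      exact intCast_ne_of_lt (k := k) (by omega) (by omega) h3
    rintro ⟨r, c⟩ ⟨s, d⟩ h1 h2 hcd
    simp only at hcd
    subst hcd
    rcases lt_trichotomy r s with h | rfl | h
    · exact (aux r s c h h1 h2).elim
    · rfl
    · exact (aux s r c h h2 h1).elim

end ChainTableau

/-- For any `k`-bounded partitions `λ` and `μ`: `𝒦^{(k)}_{λλ} = 1`;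
`𝒦^{(k)}_{λμ} = 0` whenever `|μ| = |λ|` and `λ` does not dominate `μ`; and
`𝒦^{(k)}_{λμ} = 0` whenever `|μ| < |λ|`. -/
theorem Kcal_triangularity
    (k : ℕ) (hk : 1 ≤ k) (lam mu : YoungDiagram)
    (hlam : IsKBounded k lam) (hmu : IsKBounded k mu) :
    Kcal k lam lam.rowLens = 1 ∧
    (mu.card = lam.card → ¬ Dominates lam mu → Kcal k lam mu.rowLens = 0) ∧
    (mu.card < lam.card → Kcal k lam mu.rowLens = 0) := by
  have hp := (coreOf_spec hk hlam).2
  refine ⟨?_, fun hcard hdom => ?_, fun hcard => ?_⟩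
  · rw [Kcal, Nat.card_eq_one_iff_exists]
    exact ⟨⟨_, isASVT_chainTableau hk hlam⟩, fun ⟨e, he⟩ =>
      Subtype.ext (he.unique hk hp (isASVT_chainTableau hk hlam))⟩
  · have : IsEmpty {e : ℕ × ℕ → Finset ℕ // IsASVT k mu.rowLens (coreOf k lam) e} :=
      ⟨fun ⟨e, he⟩ => hdom ((he.card_le_and_dominates hk hp).2 hcard)⟩
    rw [Kcal, Nat.card_of_isEmpty]
  · have : IsEmpty {e : ℕ × ℕ → Finset ℕ // IsASVT k mu.rowLens (coreOf k lam) e} :=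
      ⟨fun ⟨e, he⟩ => by have := (he.card_le_and_dominates hk hp).1; omega⟩
    rw [Kcal, Nat.card_of_isEmpty]

end AffineKTheory
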